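/- Let H be an infinite-dimensional separable complex Hilbert space and let T be a bounded linear operator on H. The following are equivalent: (a) T has property (CN); (b) either (i) there exist λ, μ ∈ ℂ and a selfadjoint bounded operator L on H (L = L†) such that T = λ·1 + μ·L, or (ii) there exist λ, μ ∈ ℂ with μ ≠ 0 and a unitary operator U on H such that T = λ·1 + μ·U and U − z·1 is Fredholm for every z ∈ ℂ with Re z < 0. -/

import Mathlib

open ContinuousLinearMap

/-- `P` is an orthogonal projection. -/
def IsOrthoProj {H : Type*} [NormedAddCommGroup H] [InnerProductSpace ℂ H]
    [CompleteSpace H] (P : H →L[ℂ] H) : Prop :=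
  P * P = P ∧ ContinuousLinearMap.adjoint P = P

/-- Property (CN): the two off-diagonal corners always have the same norm. -/
def HasCN {H : Type*} [NormedAddCommGroup H] [InnerProductSpace ℂ H]
    [CompleteSpace H] (T : H →L[ℂ] H) : Prop :=
  ∀ P : H →L[ℂ] H, IsOrthoProj P →
    ‖P * T * (1 - P)‖ = ‖(1 - P) * T * P‖

/-- `A` is a Fredholm operator. -/
def IsFredholmOp {H : Type*} [NormedAddCommGroup H] [InnerProductSpace ℂ H]
    [CompleteSpace H] (A : H →L[ℂ] H) : Prop :=
  FiniteDimensional ℂ (LinearMap.ker (A : H →ₗ[ℂ] H)) ∧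
  IsClosed (LinearMap.range (A : H →ₗ[ℂ] H) : Set H) ∧
  FiniteDimensional ℂ (LinearMap.ker ((ContinuousLinearMap.adjoint A : H →L[ℂ] H) : H →ₗ[ℂ] H))

section CN

variable {H : Type*} [NormedAddCommGroup H] [InnerProductSpace ℂ H] [CompleteSpace H]

/-- `A` is bounded below on the orthogonal complement of a finite-dimensional subspace. -/
def EssBoundedBelow (A : H →L[ℂ] H) : Prop :=
  ∃ M : Submodule ℂ H, FiniteDimensional ℂ M ∧ ∃ c > 0, ∀ x ∈ Mᗮ, c * ‖x‖ ≤ ‖A x‖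

theorem isClosed_map_of_bound (A : H →L[ℂ] H) (K : Submodule ℂ H) (hK : IsClosed (K : Set H))
    {c : ℝ} (hc : 0 < c) (h : ∀ x ∈ K, c * ‖x‖ ≤ ‖A x‖) :
    IsClosed ((K.map (A : H →ₗ[ℂ] H) : Submodule ℂ H) : Set H) := by
  have : CompleteSpace K := hK.completeSpace_coe
  have hanti : AntilipschitzWith (⟨c⁻¹, by positivity⟩ : NNReal) (A ∘L K.subtypeL) := by
    refine antilipschitz_of_bound _ fun x => ?_
    have h1 := h x x.2
    change ‖(x : H)‖ ≤ c⁻¹ * ‖A x‖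
    rw [inv_mul_eq_div, le_div_iff₀ hc]
    linarith
  have := hanti.isClosed_range (A ∘L K.subtypeL).uniformContinuous
  convert this using 1
  ext y
  simp

theorem EssBoundedBelow.isFredholmOp {A : H →L[ℂ] H} (hA : IsStarNormal A)
    (h : EssBoundedBelow A) : IsFredholmOp A := by
  obtain ⟨M, hM, c, hc, hb⟩ := h
  have hker : FiniteDimensional ℂ (LinearMap.ker (A : H →ₗ[ℂ] H)) := by
    let φ : LinearMap.ker (A : H →ₗ[ℂ] H) →ₗ[ℂ] M :=
      (M.orthogonalProjectionOnto : H →ₗ[ℂ] M) ∘ₗ (LinearMap.ker (A : H →ₗ[ℂ] H)).subtype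
    refine FiniteDimensional.of_injective φ ?_
    rw [injective_iff_map_eq_zero]
    rintro ⟨x, hx⟩ h0
    have h1 : x ∈ Mᗮ := by
      rw [← Submodule.orthogonalProjectionOnto_eq_zero_iff]
      exact h0
    have h2 := hb x h1
    have h3 : A x = 0 := hx
    rw [h3, norm_zero] at h2
    have : ‖x‖ = 0 := le_antisymm (by nlinarith [norm_nonneg x]) (norm_nonneg x)
    simpa using this
  refine ⟨hker, ?_, ?_⟩
  · have h1 := isClosed_map_of_bound A Mᗮ M.isClosed_orthogonal hc hb
    have h2 := Submodule.isClosed_sup_finiteDimensional _ (M.map (A : H →ₗ[ℂ] H)) h1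
    rw [← Submodule.map_sup, sup_comm, Submodule.sup_orthogonal_of_hasOrthogonalProjection,
      Submodule.map_top] at h2
    exact h2
  · have := hA.ker_adjoint_eq_ker
    rw [this]
    exact hker

theorem IsFredholmOp.essBoundedBelow {A : H →L[ℂ] H} (h : IsFredholmOp A) :
    ∃ c > 0, ∀ x ∈ (LinearMap.ker (A : H →ₗ[ℂ] H))ᗮ, c * ‖x‖ ≤ ‖A x‖ := by
  obtain ⟨hk, hr, -⟩ := h
  set M := LinearMap.ker (A : H →ₗ[ℂ] H)
  have hinj : Function.Injective (A ∘L (Mᗮ).subtypeL) := by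
    rw [injective_iff_map_eq_zero]
    rintro ⟨x, hx⟩ h0
    have h1 : x ∈ M := h0
    have := Submodule.mem_bot ℂ |>.1 (M.inf_orthogonal_eq_bot ▸ Submodule.mem_inf.2 ⟨h1, hx⟩)
    simpa using this
  have hran : IsClosed (Set.range (A ∘L (Mᗮ).subtypeL)) := by
    convert hr using 1
    ext y
    constructor
    · rintro ⟨x, rfl⟩
      exact ⟨x, rfl⟩
    · rintro ⟨x, rfl⟩
      obtain ⟨y, hy, z, hz, rfl⟩ := M.exists_add_mem_mem_orthogonal x
      refine ⟨⟨z, hz⟩, ?_⟩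
      have : A y = 0 := hy
      simp [this]
  obtain ⟨K, hK⟩ := antilipschitz_of_injective_of_isClosed_range _ hinj hran
  refine ⟨((K : ℝ) + 1)⁻¹, by positivity, fun x hx => ?_⟩
  have h1 := bound_of_antilipschitz _ hK ⟨x, hx⟩
  have h1' : ‖x‖ ≤ K * ‖A x‖ := h1
  rw [inv_mul_le_iff₀ (by positivity)]
  nlinarith [norm_nonneg (A x)]

theorem isStarNormal_sub_smul_one {A : H →L[ℂ] H} (hA : IsStarNormal A) (z : ℂ) :
    IsStarNormal (A - z • 1) := by
  refine ⟨?_⟩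
  have := hA.star_comm_self
  simp only [star_sub, star_smul, star_one]
  refine Commute.sub_left (Commute.sub_right this ?_) (Commute.sub_right ?_ ?_)
  · exact (Commute.one_right _).smul_right _
  · exact (Commute.one_left _).smul_left _
  · exact ((Commute.one_left _).smul_left _).smul_right _

theorem isUnit_of_isStarNormal_of_bound {A : H →L[ℂ] H} (hA : IsStarNormal A) {c : ℝ} (hc : 0 < c)
    (h : ∀ x, c * ‖x‖ ≤ ‖A x‖) : IsUnit A := by
  rw [isUnit_iff_bijective]
  have hinj : Function.Injective A := by
    rw [injective_iff_map_eq_zero]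
    intro x hx
    have := h x
    rw [hx, norm_zero] at this
    have : ‖x‖ = 0 := le_antisymm (by nlinarith [norm_nonneg x]) (norm_nonneg x)
    simpa using this
  refine ⟨hinj, ?_⟩
  have hcl := isClosed_map_of_bound A ⊤ isClosed_univ hc (fun x _ => h x)
  have hort : (A.range)ᗮ = ⊥ := by
    rw [hA.orthogonal_range]
    exact LinearMap.ker_eq_bot.2 hinj
  have : A.range = ⊤ := by
    rw [Submodule.map_top] at hcl
    have : IsClosed ((A.range : Submodule ℂ H) : Set H) := hcl
    have hc : CompleteSpace A.range := this.completeSpace_coe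
    exact (Submodule.orthogonal_eq_bot_iff).1 hort
  exact LinearMap.range_eq_top.1 this

theorem norm_apply_of_adjoint_mul_eq_one {U : H →L[ℂ] H} (hU : adjoint U * U = 1) (x : H) :
    ‖U x‖ = ‖x‖ := (norm_map_iff_adjoint_comp_self U).2 hU x

theorem norm_adjoint_apply_of_mul_adjoint_eq_one {U : H →L[ℂ] H} (hU : U * adjoint U = 1) (x : H) :
    ‖adjoint U x‖ = ‖x‖ :=
  norm_apply_of_adjoint_mul_eq_one (by rwa [adjoint_adjoint]) x

theorem isStarNormal_of_unitary {U : H →L[ℂ] H} (h₁ : adjoint U * U = 1)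
    (h₂ : U * adjoint U = 1) : IsStarNormal U :=
  ⟨by rw [star_eq_adjoint, Commute, SemiconjBy, h₁, h₂]⟩

theorem neg_mul_norm_sq_le_re_inner_of_spectrum {A : H →L[ℂ] H} (hA : IsStarNormal A) {ε : ℝ}
    (h : ∀ z ∈ spectrum ℂ A, -ε ≤ z.re) (x : H) :
    -ε * ‖x‖ ^ 2 ≤ (inner ℂ x (A x)).re := by
  set N : H →L[ℂ] H := cfc (fun z : ℂ => (Real.sqrt (z.re + ε) : ℂ)) A with hN
  have hcont : Continuous (fun z : ℂ => (Real.sqrt (z.re + ε) : ℂ)) := by fun_prop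
  have h1 : (2 : ℂ) • (adjoint N * N) = A + adjoint A + ((2 * ε : ℝ) : ℂ) • 1 := by
    rw [← star_eq_adjoint, ← star_eq_adjoint, hN, ← cfc_star, ← cfc_mul .., ← cfc_smul ..]
    have h2 : A + star A + ((2 * ε : ℝ) : ℂ) • (1 : H →L[ℂ] H) =
        cfc (fun z : ℂ => z + star z + ((2 * ε : ℝ) : ℂ)) A := by
      rw [cfc_add .., cfc_add .., cfc_id' .., cfc_star .., cfc_id' .., cfc_const _ _,
        Algebra.algebraMap_eq_smul_one]
    rw [h2]
    refine cfc_congr fun z hz => ?_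
    have h3 := h z hz
    have h4 := Real.mul_self_sqrt (show 0 ≤ z.re + ε by linarith)
    have h5 : z + star z = ((2 * z.re : ℝ) : ℂ) := by
      simpa using Complex.add_conj z
    rw [h5]
    simp only [smul_eq_mul, RCLike.star_def, Complex.conj_ofReal]
    rw [← Complex.ofReal_mul, h4]
    push_cast
    ring
  have h2 : (2 : ℂ) • adjoint N (N x) = A x + adjoint A x + ((2 * ε : ℝ) : ℂ) • x :=
    congrArg (fun B : H →L[ℂ] H => B x) h1
  have h3 := congrArg (fun y => (inner ℂ x y).re) h2
  have h4 : (inner ℂ (A x) x).re = (inner ℂ x (A x)).re := by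
    rw [← inner_conj_symm, Complex.conj_re]
  simp only [inner_add_right, inner_smul_right, adjoint_inner_right, Complex.add_re, h4,
    inner_self_eq_norm_sq_to_K, Complex.re_ofReal_mul, Complex.coe_algebraMap] at h3
  norm_cast at h3
  nlinarith [sq_nonneg ‖N x‖]

theorem exists_reducing_bound {U : H →L[ℂ] H} (h₁ : adjoint U * U = 1)
    (hF : ∀ z : ℂ, z.re < 0 → IsFredholmOp (U - z • 1)) {ε : ℝ} (hε : 0 < ε) :
    ∃ M : Submodule ℂ H, FiniteDimensional ℂ M ∧ (∀ x ∈ M, U x ∈ M) ∧ (∀ x ∈ M, adjoint U x ∈ M) ∧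
      ∃ c > 0, ∀ z ∈ {z : ℂ | ‖z‖ = 1 ∧ z.re ≤ -ε}, ∀ x ∈ Mᗮ, c * ‖x‖ ≤ ‖U x - z • x‖ := by
  have hS : IsCompact {z : ℂ | ‖z‖ = 1 ∧ z.re ≤ -ε} := by
    have : {z : ℂ | ‖z‖ = 1 ∧ z.re ≤ -ε} = Metric.sphere 0 1 ∩ {z : ℂ | z.re ≤ -ε} := by
      ext z; simp
    rw [this]
    exact (isCompact_sphere _ _).inter_right (isClosed_le Complex.continuous_re continuous_const)
  refine hS.induction_on (p := fun S => ∃ M : Submodule ℂ H, FiniteDimensional ℂ M ∧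
    (∀ x ∈ M, U x ∈ M) ∧ (∀ x ∈ M, adjoint U x ∈ M) ∧
      ∃ c > 0, ∀ z ∈ S, ∀ x ∈ Mᗮ, c * ‖x‖ ≤ ‖U x - z • x‖) ?_ ?_ ?_ ?_
  · exact ⟨⊥, inferInstance, by simp, by simp, 1, one_pos, by simp⟩
  · rintro s t hst ⟨M, hM, hU, hU', c, hc, h⟩
    exact ⟨M, hM, hU, hU', c, hc, fun z hz => h z (hst hz)⟩
  · rintro s t ⟨M, hM, hU, hU', c, hc, h⟩ ⟨N, hN, hV, hV', d, hd, k⟩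
    refine ⟨M ⊔ N, inferInstance, ?_, ?_, min c d, lt_min hc hd, ?_⟩
    · intro x hx
      obtain ⟨y, hy, z, hz, rfl⟩ := Submodule.mem_sup.1 hx
      rw [map_add]
      exact Submodule.add_mem_sup (hU y hy) (hV z hz)
    · intro x hx
      obtain ⟨y, hy, z, hz, rfl⟩ := Submodule.mem_sup.1 hx
      rw [map_add]
      exact Submodule.add_mem_sup (hU' y hy) (hV' z hz)
    · intro z hz x hx
      rw [← Submodule.inf_orthogonal] at hx
      rcases hz with hz | hz
      · exact le_trans (by gcongr; exact min_le_left _ _) (h z hz x hx.1)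
      · exact le_trans (by gcongr; exact min_le_right _ _) (k z hz x hx.2)
  · rintro z ⟨hz1, hz2⟩
    obtain ⟨c, hc, h⟩ := (hF z (by linarith)).essBoundedBelow
    refine ⟨Metric.ball z (c / 2), mem_nhdsWithin_of_mem_nhds (Metric.ball_mem_nhds _ (by positivity)),
      _, (hF z (by linarith)).1, ?_, ?_, c / 2, by positivity, ?_⟩
    · intro x hx
      have hx' : U x = z • x := by simpa [sub_eq_zero] using hx
      rw [hx']
      exact Submodule.smul_mem _ _ hx
    · intro x hx
      have hx' : U x = z • x := by simpa [sub_eq_zero] using hx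
      have hz0 : z ≠ 0 := by rintro rfl; simp at hz1
      have h2 : adjoint U x = z⁻¹ • x := by
        have h3 : adjoint U (U x) = x := congrArg (fun B : H →L[ℂ] H => B x) h₁
        rw [hx', map_smul] at h3
        rw [eq_inv_smul_iff₀ hz0, h3]
      rw [h2]
      exact Submodule.smul_mem _ _ hx
    · intro w hw x hx
      have h3 := h x hx
      have h4 : (U - z • 1) x = (U x - w • x) + (w - z) • x := by
        simp [sub_smul]
      rw [h4] at h3
      have h5 := norm_add_le (U x - w • x) ((w - z) • x)
      rw [norm_smul, ← dist_eq_norm w z] at h5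
      have h6 : dist w z * ‖x‖ ≤ c / 2 * ‖x‖ := by gcongr; exact (Metric.mem_ball.1 hw).le
      linarith

omit [CompleteSpace H] in
theorem norm_sq_add_of_mem_orthogonal {M : Submodule ℂ H} {u v : H} (hu : u ∈ M) (hv : v ∈ Mᗮ) :
    ‖v + u‖ ^ 2 = ‖v‖ ^ 2 + ‖u‖ ^ 2 := by
  have := norm_add_sq_eq_norm_sq_add_norm_sq_of_inner_eq_zero v u
    (Submodule.inner_left_of_mem_orthogonal hu hv)
  simpa [sq] using this

/-- A unitary operator with no essential spectrum in the open left half-plane is a finite-rank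
perturbation of an operator with numerical range in `{z | -ε ≤ Re z}`. -/
theorem exists_finiteRank_perturbation {U : H →L[ℂ] H} (h₁ : adjoint U * U = 1)
    (h₂ : U * adjoint U = 1) (hF : ∀ z : ℂ, z.re < 0 → IsFredholmOp (U - z • 1)) {ε : ℝ}
    (hε : 0 < ε) :
    ∃ W K : H →L[ℂ] H, IsCompactOperator K ∧ U = W + K ∧
      ∀ x, -ε * ‖x‖ ^ 2 ≤ (inner ℂ x (W x)).re := by
  obtain ⟨M, hM, hUM, hU'M, c, hc, hb⟩ := exists_reducing_bound h₁ hF hε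
  have hUo : ∀ x ∈ Mᗮ, U x ∈ Mᗮ := fun x hx => by
    rw [Submodule.mem_orthogonal] at hx ⊢
    intro u hu
    rw [← adjoint_inner_left]
    exact hx _ (hU'M u hu)
  have hU'o : ∀ x ∈ Mᗮ, adjoint U x ∈ Mᗮ := fun x hx => by
    rw [Submodule.mem_orthogonal] at hx ⊢
    intro u hu
    rw [adjoint_inner_right]
    exact hx _ (hUM u hu)
  set Q := M.starProjection with hQ
  set R := Mᗮ.starProjection with hR
  have hQR : ∀ x, x = R x + Q x := fun x => by
    rw [hR, hQ, add_comm, Submodule.starProjection_add_starProjection_orthogonal]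
  have hQM : ∀ x, Q x ∈ M := fun x => M.starProjection_apply_mem x
  have hRM : ∀ x, R x ∈ Mᗮ := fun x => Mᗮ.starProjection_apply_mem x
  have hsplit : ∀ x, ‖x‖ ^ 2 = ‖R x‖ ^ 2 + ‖Q x‖ ^ 2 := fun x => by
    conv_lhs => rw [hQR x, norm_sq_add_of_mem_orthogonal (hQM x) (hRM x)]
  have hRU : U * R = R * U := by
    ext x
    change U (R x) = R (U x)
    refine (Submodule.eq_starProjection_of_mem_orthogonal (hUo _ (hRM x)) ?_).symm
    have : U x - U (R x) = U (Q x) := by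
      conv_lhs => rw [hQR x, map_add, ← hQR x]
      simp
    rw [this]
    exact M.le_orthogonal_orthogonal (hUM _ (hQM x))
  have hadjR : adjoint R = R := isSelfAdjoint_starProjection Mᗮ
  have hadjQ : adjoint Q = Q := isSelfAdjoint_starProjection M
  have hcomp : IsCompactOperator (Q - U * Q) := by
    have hQc : IsCompactOperator Q :=
      ((isCompactOperator_of_locallyCompactSpace_rng (ContinuousLinearMap.id ℂ M)).clm_comp
        M.subtypeL).comp_clm M.orthogonalProjectionOnto
    exact hQc.sub (hQc.clm_comp U)
  have hdec : U = (U * R + Q) - (Q - U * Q) := by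
    have : R + Q = 1 := by ext x; exact (hQR x).symm
    calc U = U * (R + Q) := by rw [this, mul_one]
      _ = _ := by noncomm_ring
  refine ⟨U * R + Q, -(Q - U * Q), hcomp.neg, by rw [← sub_eq_add_neg]; exact hdec, ?_⟩
  have hadj : adjoint (U * R + Q) = adjoint U * R + Q := by
    have h3 := congrArg adjoint hRU
    have h4 : adjoint (U * R) = R * adjoint U := by
      rw [← star_eq_adjoint, star_mul, star_eq_adjoint, star_eq_adjoint, hadjR]
    have h5 : adjoint (R * U) = adjoint U * R := by
      rw [← star_eq_adjoint, star_mul, star_eq_adjoint, star_eq_adjoint, hadjR]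
    rw [map_add, hadjQ, h3, h5]
  have hnorm : IsStarNormal (U * R + Q) := by
    rw [isStarNormal_iff_norm_eq_adjoint]
    intro x
    rw [hadj, ← sq_eq_sq₀ (norm_nonneg _) (norm_nonneg _)]
    change ‖U (R x) + Q x‖ ^ 2 = ‖adjoint U (R x) + Q x‖ ^ 2
    rw [norm_sq_add_of_mem_orthogonal (hQM x) (hUo _ (hRM x)),
      norm_sq_add_of_mem_orthogonal (hQM x) (hU'o _ (hRM x)),
      norm_apply_of_adjoint_mul_eq_one h₁, norm_adjoint_apply_of_mul_adjoint_eq_one h₂]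
  refine neg_mul_norm_sq_le_re_inner_of_spectrum hnorm fun z hz => ?_
  by_contra! hlt
  have hz1 : z ≠ 1 := by
    rintro rfl
    simp at hlt
    linarith
  obtain ⟨d, hd, hbd⟩ : ∃ d > 0, ∀ x ∈ Mᗮ, d * ‖x‖ ≤ ‖U x - z • x‖ := by
    by_cases hzn : ‖z‖ = 1
    · exact ⟨c, hc, hb z ⟨hzn, hlt.le⟩⟩
    · refine ⟨|1 - ‖z‖|, abs_pos.2 (sub_ne_zero.2 (Ne.symm hzn)), fun x _ => ?_⟩
      have := abs_norm_sub_norm_le (U x) (z • x)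
      rw [norm_apply_of_adjoint_mul_eq_one h₁, norm_smul] at this
      rwa [show ‖x‖ - ‖z‖ * ‖x‖ = (1 - ‖z‖) * ‖x‖ by ring, abs_mul, abs_norm] at this
  have he : 0 < min d ‖1 - z‖ := lt_min hd (norm_pos_iff.2 (sub_ne_zero.2 (Ne.symm hz1)))
  have hunit : IsUnit (U * R + Q - z • 1) := by
    refine isUnit_of_isStarNormal_of_bound (isStarNormal_sub_smul_one hnorm z) he fun x => ?_
    have h3 : (U * R + Q - z • 1) x = (U (R x) - z • R x) + (1 - z) • Q x := by
      change U (R x) + Q x - z • x = _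
      nth_rw 3 [hQR x]
      rw [smul_add, sub_smul, one_smul]
      abel
    rw [← sq_le_sq₀ (by positivity) (norm_nonneg _), h3,
      norm_sq_add_of_mem_orthogonal (Submodule.smul_mem _ _ (hQM x))
        (Submodule.sub_mem _ (hUo _ (hRM x)) (Submodule.smul_mem _ _ (hRM x))),
      mul_pow, hsplit x, mul_add, norm_smul, mul_pow ‖1 - z‖]
    have h4 : min d ‖1 - z‖ * ‖R x‖ ≤ ‖U (R x) - z • R x‖ :=
      le_trans (by gcongr; exact min_le_left _ _) (hbd _ (hRM x))
    have h5 : (min d ‖1 - z‖ * ‖R x‖) ^ 2 ≤ ‖U (R x) - z • R x‖ ^ 2 := by gcongr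
    rw [mul_pow] at h5
    have h6 : min d ‖1 - z‖ ^ 2 * ‖Q x‖ ^ 2 ≤ ‖1 - z‖ ^ 2 * ‖Q x‖ ^ 2 := by
      gcongr; exact min_le_right _ _
    linarith
  have h7 := spectrum.mem_iff.1 hz
  apply h7
  rw [← neg_sub, IsUnit.neg_iff, Algebra.algebraMap_eq_smul_one]
  exact hunit

theorem IsOrthoProj.apply_apply {P : H →L[ℂ] H} (hP : IsOrthoProj P) (x : H) : P (P x) = P x :=
  congrArg (fun B : H →L[ℂ] H => B x) hP.1

theorem IsOrthoProj.inner_left {P : H →L[ℂ] H} (hP : IsOrthoProj P) (x y : H) :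
    inner ℂ (P x) y = inner ℂ x (P y) := by
  conv_lhs => rw [← hP.2, adjoint_inner_left]

theorem IsOrthoProj.norm_sq {P : H →L[ℂ] H} (hP : IsOrthoProj P) (x : H) :
    ‖x‖ ^ 2 = ‖P x‖ ^ 2 + ‖x - P x‖ ^ 2 := by
  have h : inner ℂ (P x) (x - P x) = 0 := by
    rw [hP.inner_left, map_sub, hP.apply_apply, sub_self, inner_zero_right]
  have := norm_add_sq_eq_norm_sq_add_norm_sq_of_inner_eq_zero _ _ h
  rw [add_sub_cancel] at this
  simpa [sq] using this

theorem IsOrthoProj.norm_apply_le {P : H →L[ℂ] H} (hP : IsOrthoProj P) (x : H) :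
    ‖P x‖ ≤ ‖x‖ := by
  rw [← sq_le_sq₀ (norm_nonneg _) (norm_nonneg _), hP.norm_sq x]
  nlinarith [sq_nonneg ‖x - P x‖]

/-- The upper corner of `T` has the same norm as the lower corner of the adjoint of `T`. -/
theorem IsOrthoProj.norm_corner_adjoint {P : H →L[ℂ] H} (hP : IsOrthoProj P) (T : H →L[ℂ] H) :
    ‖P * T * (1 - P)‖ = ‖(1 - P) * adjoint T * P‖ := by
  rw [← LinearIsometryEquiv.norm_map adjoint (P * T * (1 - P))]
  congr 1
  rw [← star_eq_adjoint, star_mul, star_mul, star_sub, star_one, star_eq_adjoint, star_eq_adjoint,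
    hP.2, mul_assoc]

/-- The lower corner has norm at most `s` exactly when it does so on the range of `P`. -/
theorem IsOrthoProj.norm_corner_le {P : H →L[ℂ] H} (hP : IsOrthoProj P) (T : H →L[ℂ] H) {s : ℝ}
    (hs : 0 ≤ s) (h : ∀ x, P x = x → ‖T x - P (T x)‖ ≤ s * ‖x‖) : ‖(1 - P) * T * P‖ ≤ s := by
  refine opNorm_le_bound _ hs fun x => ?_
  exact (h (P x) (hP.apply_apply x)).trans (by gcongr; exact hP.norm_apply_le x)

omit [CompleteSpace H] in
theorem corner_apply_le {P : H →L[ℂ] H} (T : H →L[ℂ] H)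
    {x : H} (hx : P x = x) : ‖T x - P (T x)‖ ≤ ‖(1 - P) * T * P‖ * ‖x‖ := by
  have := le_opNorm ((1 - P) * T * P) x
  have h2 : ((1 - P) * T * P) x = T (P x) - P (T (P x)) := rfl
  rwa [h2, hx] at this

theorem isUnit_of_isUnit_add_smul {A : H →L[ℂ] H} {t d : ℝ} (ht : 0 ≤ t) (htd : 2 * t < d)
    (hb : ∀ x, d * ‖x‖ ≤ ‖A x‖) (hu : IsUnit (A + (t : ℂ) • 1)) : IsUnit A := by
  obtain ⟨u, hu⟩ := hu
  set V : H →L[ℂ] H := ↑u⁻¹ with hV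
  have h1 : ∀ x, (d - t) * ‖V x‖ ≤ ‖x‖ := fun x => by
    have h2 : (A + (t : ℂ) • 1) (V x) = x := by
      rw [← hu]
      exact congrArg (fun B : H →L[ℂ] H => B x) u.mul_inv
    have h3 : A (V x) = x - (t : ℂ) • V x := by
      rw [eq_sub_iff_add_eq]; exact h2
    have h4 := hb (V x)
    have h5 := norm_sub_le x ((t : ℂ) • V x)
    rw [h3] at h4
    rw [norm_smul, Complex.norm_real, Real.norm_of_nonneg ht] at h5
    linarith
  have h2 : ‖(t : ℂ) • V‖ < 1 := by
    have h3 : ‖V‖ ≤ (d - t)⁻¹ := opNorm_le_bound _ (by simp; linarith) fun x => by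
      rw [inv_mul_eq_div, le_div_iff₀ (by linarith)]
      linarith [h1 x]
    rw [norm_smul, Complex.norm_real, Real.norm_of_nonneg ht]
    calc t * ‖V‖ ≤ t * (d - t)⁻¹ := by gcongr
      _ < 1 := by rw [← div_eq_mul_inv, div_lt_one (by linarith)]; linarith
  have h3 : A = ↑u * (1 - (t : ℂ) • V) := by
    rw [mul_sub, mul_one, hu, mul_smul_comm, ← hu, hV, u.mul_inv, hu]
    simp
  rw [h3]
  exact u.isUnit.mul (Units.oneSub _ h2).isUnit

theorem isUnit_add_of_isCompactOperator {B K : H →L[ℂ] H} (hB : IsUnit B)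
    (hK : IsCompactOperator K) (hinj : ∀ x, (B + K) x = 0 → x = 0) : IsUnit (B + K) := by
  obtain ⟨u, rfl⟩ := hB
  have hK' : IsCompactOperator (-((↑u⁻¹ : H →L[ℂ] H) * K)) := (hK.clm_comp (↑u⁻¹ : H →L[ℂ] H)).neg
  have hfac : (u : H →L[ℂ] H) + K = u * (1 - -((↑u⁻¹ : H →L[ℂ] H) * K)) := by
    rw [sub_neg_eq_add, mul_add, mul_one, ← mul_assoc, u.mul_inv, one_mul]
  rcases hK'.hasEigenvalue_or_mem_resolventSet one_ne_zero with h | h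
  · obtain ⟨x, hx, hx0⟩ := h.exists_hasEigenvector
    refine absurd (hinj x ?_) hx0
    have hx1 : (-((↑u⁻¹ : H →L[ℂ] H) * K)) x = x := by
      simpa using Module.End.mem_eigenspace_iff.1 hx
    rw [hfac]
    change (u : H →L[ℂ] H) (x - (-((↑u⁻¹ : H →L[ℂ] H) * K)) x) = 0
    rw [hx1, sub_self, map_zero]
  · rw [hfac]
    refine u.isUnit.mul ?_
    simpa [spectrum.mem_resolventSet_iff] using h

theorem compression_bound_adjoint {U : H →L[ℂ] H} (h₁ : adjoint U * U = 1)
    (h₂ : U * adjoint U = 1) (hF : ∀ z : ℂ, z.re < 0 → IsFredholmOp (U - z • 1))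
    {P : H →L[ℂ] H} (hP : IsOrthoProj P) {c : ℝ} (hc : 0 < c)
    (hb : ∀ x, P x = x → c * ‖x‖ ≤ ‖P (U x)‖) (x : H) (hx : P x = x) :
    c * ‖x‖ ≤ ‖P (adjoint U x)‖ := by
  set A : H →L[ℂ] H := P * U * P + (1 - P) with hA
  have hAx : ∀ x, A x = P (U (P x)) + (x - P x) := fun _ => rfl
  set d := min c 1 with hd
  have hd0 : 0 < d := lt_min hc one_pos
  have hPA : ∀ y, P (A y) = P (U (P y)) := fun y => by
    rw [hAx, map_add, map_sub, hP.apply_apply, hP.apply_apply, sub_self, add_zero]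
  have hAb : ∀ y, d * ‖y‖ ≤ ‖A y‖ := fun y => by
    have h3 : A y - P (A y) = y - P y := by rw [hPA, hAx]; abel
    rw [← sq_le_sq₀ (by positivity) (norm_nonneg _), hP.norm_sq (A y), h3, hPA, mul_pow,
      hP.norm_sq y, mul_add]
    have h4 := hb (P y) (hP.apply_apply y)
    have h5 : d * ‖P y‖ ≤ ‖P (U (P y))‖ := le_trans (by gcongr; exact min_le_left _ _) h4
    have h6 : (d * ‖P y‖) ^ 2 ≤ ‖P (U (P y))‖ ^ 2 := by gcongr
    have h7 : d ^ 2 * ‖y - P y‖ ^ 2 ≤ 1 * ‖y - P y‖ ^ 2 := by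
      gcongr
      exact pow_le_one₀ hd0.le (min_le_right _ _)
    rw [mul_pow] at h6
    linarith
  have hunit : IsUnit A := by
    set t := d / 4 with ht
    have ht0 : 0 < t := by positivity
    refine isUnit_of_isUnit_add_smul (t := t) ht0.le (by linarith) hAb ?_
    obtain ⟨W, K, hK, hUW, hW⟩ := exists_finiteRank_perturbation h₁ h₂ hF (half_pos ht0)
    have hdec : A + (t : ℂ) • 1 = (P * W * P + (1 - P) + (t : ℂ) • 1) + P * K * P := by
      rw [hA, hUW]; noncomm_ring
    rw [hdec]
    refine isUnit_add_of_isCompactOperator ?_ ((hK.clm_comp P).comp_clm P) ?_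
    · refine isUnit_of_forall_le_norm_inner_map _ (c := ⟨t / 2, by positivity⟩)
        (show 0 < t / 2 by positivity) fun y => ?_
      change ‖y‖ ^ 2 * (t / 2) ≤ ‖inner ℂ (P (W (P y)) + (y - P y) + (t : ℂ) • y) y‖
      rw [norm_inner_symm]
      refine le_trans ?_ (Complex.re_le_norm _)
      have h3 := hW (P y)
      have h4 : inner ℂ y (y - P y) = inner ℂ (y - P y) (y - P y) := by
        rw [inner_sub_left y (P y) (y - P y), hP.inner_left, map_sub, hP.apply_apply, sub_self,
          inner_zero_right, sub_zero]
      rw [inner_add_right, inner_add_right, h4, ← hP.inner_left, inner_smul_right,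
        inner_self_eq_norm_sq_to_K, inner_self_eq_norm_sq_to_K, Complex.add_re, Complex.add_re,
        Complex.re_ofReal_mul]
      simp only [Complex.coe_algebraMap, ← Complex.ofReal_pow, Complex.ofReal_re]
      have h5 := hP.norm_sq y
      nlinarith [sq_nonneg ‖y - P y‖, sq_nonneg ‖P y‖]
    · intro y hy
      rw [← hdec] at hy
      have h3 : A y = -((t : ℂ) • y) := by rw [eq_neg_iff_add_eq_zero]; exact hy
      have h4 := hAb y
      rw [h3, norm_neg, norm_smul, Complex.norm_real, Real.norm_of_nonneg ht0.le] at h4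
      have : ‖y‖ = 0 := le_antisymm (by nlinarith [norm_nonneg y]) (norm_nonneg y)
      simpa using this
  obtain ⟨y, rfl⟩ := ((isUnit_iff_bijective.1 hunit).2 x)
  have hy : P y = y := by
    rw [hPA, hAx] at hx
    have := sub_eq_zero.1 (left_eq_add.1 hx)
    exact this.symm
  have h3 : A y = P (U y) := by rw [hAx, hy, sub_self, add_zero]
  have h4 := hb y hy
  rw [← h3] at h4
  have h5 : ‖A y‖ ^ 2 ≤ ‖y‖ * ‖P (adjoint U (A y))‖ := by
    have h6 : inner ℂ (A y) (A y) = inner ℂ y (P (adjoint U (A y))) := by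
      nth_rw 1 [h3]
      rw [hP.inner_left, hx, ← adjoint_inner_right, ← hP.inner_left, hy]
    have h7 := norm_inner_le_norm (𝕜 := ℂ) y (P (adjoint U (A y)))
    rw [← h6, inner_self_eq_norm_sq_to_K] at h7
    simpa using h7
  rcases (norm_nonneg (A y)).eq_or_lt with h0 | h0
  · rw [← h0, mul_zero]; positivity
  · have h6 : ‖A y‖ * (c * ‖A y‖) ≤ ‖A y‖ * ‖P (adjoint U (A y))‖ := by
      calc ‖A y‖ * (c * ‖A y‖) = c * ‖A y‖ ^ 2 := by ring
        _ ≤ c * (‖y‖ * ‖P (adjoint U (A y))‖) := by gcongr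
        _ = (c * ‖y‖) * ‖P (adjoint U (A y))‖ := by ring
        _ ≤ _ := by gcongr
    exact le_of_mul_le_mul_left h6 h0

theorem norm_corner_adjoint_le {U : H →L[ℂ] H} (h₁ : adjoint U * U = 1)
    (h₂ : U * adjoint U = 1) (hF : ∀ z : ℂ, z.re < 0 → IsFredholmOp (U - z • 1))
    {P : H →L[ℂ] H} (hP : IsOrthoProj P) :
    ‖(1 - P) * adjoint U * P‖ ≤ ‖(1 - P) * U * P‖ := by
  set s := ‖(1 - P) * U * P‖ with hs
  have hs0 : 0 ≤ s := norm_nonneg _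
  refine hP.norm_corner_le _ hs0 fun x hx => ?_
  have h3 := hP.norm_sq (adjoint U x)
  rw [norm_adjoint_apply_of_mul_adjoint_eq_one h₂] at h3
  rw [← sq_le_sq₀ (norm_nonneg _) (by positivity), mul_pow]
  rcases le_or_gt 1 s with h1 | h1
  · have h2 : 1 ≤ s ^ 2 := one_le_pow₀ h1
    nlinarith [sq_nonneg ‖P (adjoint U x)‖, mul_le_mul_of_nonneg_right h2 (sq_nonneg ‖x‖)]
  · have hc : 0 < 1 - s ^ 2 := by nlinarith
    have h4 := compression_bound_adjoint h₁ h₂ hF hP (Real.sqrt_pos.2 hc) (fun y hy => by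
      rw [← sq_le_sq₀ (by positivity) (norm_nonneg _), mul_pow, Real.sq_sqrt hc.le]
      have h5 := hP.norm_sq (U y)
      rw [norm_apply_of_adjoint_mul_eq_one h₁] at h5
      have h6 := corner_apply_le U hy
      rw [← sq_le_sq₀ (by positivity) (by positivity), ← hs, mul_pow] at h6
      nlinarith) x hx
    rw [← sq_le_sq₀ (by positivity) (norm_nonneg _), mul_pow, Real.sq_sqrt hc.le] at h4
    nlinarith

theorem IsFredholmOp.adjoint_sub {U : H →L[ℂ] H} (hU : IsStarNormal U) {z : ℂ}
    (hF : IsFredholmOp (U - star z • 1)) : IsFredholmOp (adjoint U - z • 1) := by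
  have hadj : adjoint (U - star z • 1) = adjoint U - z • 1 := by
    rw [← star_eq_adjoint, ← star_eq_adjoint, star_sub, star_smul, star_one, star_star]
  have hn := isStarNormal_iff_norm_eq_adjoint.1 (isStarNormal_sub_smul_one hU (star z))
  obtain ⟨c, hc, h⟩ := hF.essBoundedBelow
  refine EssBoundedBelow.isFredholmOp ?_ ⟨_, hF.1, c, hc, fun x hx => ?_⟩
  · exact isStarNormal_sub_smul_one (by rw [← star_eq_adjoint]; infer_instance) _
  · rw [← hadj, ← hn]
    exact h x hx

theorem hasCN_of_unitary {U : H →L[ℂ] H} (h₁ : adjoint U * U = 1)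
    (h₂ : U * adjoint U = 1) (hF : ∀ z : ℂ, z.re < 0 → IsFredholmOp (U - z • 1)) :
    HasCN U := by
  intro P hP
  rw [hP.norm_corner_adjoint]
  refine le_antisymm (norm_corner_adjoint_le h₁ h₂ hF hP) ?_
  have := norm_corner_adjoint_le (U := adjoint U) (by rwa [adjoint_adjoint])
    (by rwa [adjoint_adjoint]) (fun z hz => (hF (star z) (by simpa using hz)).adjoint_sub
      (isStarNormal_of_unitary h₁ h₂)) hP
  rwa [adjoint_adjoint] at this

theorem hasCN_of_adjoint_eq_self {L : H →L[ℂ] H} (hL : adjoint L = L) : HasCN L := by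
  intro P hP
  rw [hP.norm_corner_adjoint, hL]

theorem HasCN.smul_one_add_smul {T : H →L[ℂ] H} (hT : HasCN T) (l m : ℂ) :
    HasCN (l • 1 + m • T) := by
  intro P hP
  have h1 : P * (l • 1 + m • T) * (1 - P) = m • (P * T * (1 - P)) := by
    have : P * (1 - P) = 0 := by rw [mul_sub, mul_one, hP.1, sub_self]
    rw [mul_add, add_mul, mul_smul_comm, mul_one, smul_mul_assoc, this, smul_zero, zero_add,
      mul_smul_comm, smul_mul_assoc]
  have h2 : (1 - P) * (l • 1 + m • T) * P = m • ((1 - P) * T * P) := by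
    have : (1 - P) * P = 0 := by rw [sub_mul, one_mul, hP.1, sub_self]
    rw [mul_add, add_mul, mul_smul_comm, mul_one, smul_mul_assoc, this, smul_zero, zero_add,
      mul_smul_comm, smul_mul_assoc]
  rw [h1, h2, norm_smul, norm_smul, hT P hP]

theorem isOrthoProj_starProjection (K : Submodule ℂ H) [K.HasOrthogonalProjection] :
    IsOrthoProj K.starProjection :=
  ⟨K.isIdempotentElem_starProjection, isSelfAdjoint_starProjection K⟩

theorem HasCN.norm_corner_adjoint {T : H →L[ℂ] H} (hT : HasCN T) {P : H →L[ℂ] H}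
    (hP : IsOrthoProj P) : ‖(1 - P) * adjoint T * P‖ = ‖(1 - P) * T * P‖ := by
  rw [← hP.norm_corner_adjoint, hT P hP]

theorem norm_corner_singleton {e : H} (he : ‖e‖ = 1) (T : H →L[ℂ] H) :
    ‖(1 - (ℂ ∙ e).starProjection) * T * (ℂ ∙ e).starProjection‖ ^ 2 =
      ‖T e‖ ^ 2 - ‖inner ℂ e (T e)‖ ^ 2 := by
  set P := (ℂ ∙ e).starProjection with hPdef
  have hP : IsOrthoProj P := isOrthoProj_starProjection _
  have hPe : P e = e := Submodule.starProjection_eq_self_iff.2 (Submodule.mem_span_singleton_self e)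
  have h1 : ‖(1 - P) * T * P‖ = ‖T e - P (T e)‖ := by
    refine le_antisymm (hP.norm_corner_le T (norm_nonneg _) fun x hx => ?_) ?_
    · obtain ⟨a, rfl⟩ := Submodule.mem_span_singleton.1
        (Submodule.starProjection_eq_self_iff.1 hx)
      rw [map_smul, map_smul, ← smul_sub, norm_smul, norm_smul, he, mul_one, mul_comm]
    · simpa [he] using corner_apply_le T hPe
  have h2 := hP.norm_sq (T e)
  have h3 : P (T e) = inner ℂ e (T e) • e := Submodule.starProjection_unit_singleton ℂ he _
  rw [h1, h2, h3, norm_smul, he]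
  ring

theorem HasCN.isStarNormal {T : H →L[ℂ] H} (hT : HasCN T) : IsStarNormal T := by
  rw [isStarNormal_iff_norm_eq_adjoint]
  have key : ∀ e : H, ‖e‖ = 1 → ‖T e‖ = ‖adjoint T e‖ := fun e he => by
    have h1 := norm_corner_singleton he T
    have h2 := norm_corner_singleton he (adjoint T)
    rw [hT.norm_corner_adjoint (isOrthoProj_starProjection _), h1, adjoint_inner_right,
      norm_inner_symm (T e) e] at h2
    rw [← sq_eq_sq₀ (norm_nonneg _) (norm_nonneg _)]
    linarith
  intro x
  rcases eq_or_ne x 0 with rfl | hx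
  · simp
  have hx' : (‖x‖ : ℂ) ≠ 0 := by simpa using hx
  have h := key ((‖x‖⁻¹ : ℂ) • x) (norm_smul_inv_norm hx)
  rw [map_smul, map_smul, norm_smul, norm_smul] at h
  exact mul_left_cancel₀ (norm_ne_zero_iff.2 (inv_ne_zero hx')) h

omit [CompleteSpace H] in
theorem norm_smul_add_smul_sq (x y : H) (a b : ℂ) :
    ‖a • x + b • y‖ ^ 2 = ‖a‖ ^ 2 * ‖x‖ ^ 2 + ‖b‖ ^ 2 * ‖y‖ ^ 2 +
      2 * (star a * b * inner ℂ x y).re := by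
  rw [norm_add_sq (𝕜 := ℂ), inner_smul_left, inner_smul_right, norm_smul, norm_smul, mul_pow,
    mul_pow, mul_assoc (star a)]
  simp only [RCLike.re_to_complex, RCLike.star_def]
  ring

/-- The norm of the corner at a two-dimensional subspace solves the characteristic equation of the
Gram matrix of the corner. -/
theorem norm_corner_pair {u v : H} (hu : ‖u‖ = 1) (hv : ‖v‖ = 1) (huv : inner ℂ u v = 0)
    {P : H →L[ℂ] H} (hP : IsOrthoProj P) (hPu : P u = u) (hPv : P v = v)
    (hmem : ∀ x, P x = x → ∃ a b : ℂ, x = a • u + b • v) (T : H →L[ℂ] H) :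
    (‖(1 - P) * T * P‖ ^ 2 - ‖T u - P (T u)‖ ^ 2) * (‖(1 - P) * T * P‖ ^ 2 - ‖T v - P (T v)‖ ^ 2) =
      ‖inner ℂ (T u - P (T u)) (T v - P (T v))‖ ^ 2 := by
  set N := ‖(1 - P) * T * P‖ with hN
  set y := T u - P (T u) with hy
  set z := T v - P (T v) with hz
  set c := inner ℂ y z with hc
  set A := N ^ 2 - ‖y‖ ^ 2 with hA
  set B := N ^ 2 - ‖z‖ ^ 2 with hB
  have hTab : ∀ a b : ℂ, T (a • u + b • v) - P (T (a • u + b • v)) = a • y + b • z := fun a b => by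
    simp only [map_add, map_smul, hy, hz, smul_sub]
    abel
  have hab : ∀ a b : ℂ, ‖a • u + b • v‖ ^ 2 = ‖a‖ ^ 2 + ‖b‖ ^ 2 := fun a b => by
    rw [norm_smul_add_smul_sq, huv, hu, hv]; simp
  have h1 : ∀ a b : ℂ, 2 * (star a * b * c).re ≤ A * ‖a‖ ^ 2 + B * ‖b‖ ^ 2 := fun a b => by
    have h2 := corner_apply_le T (P := P) (x := a • u + b • v) (by
      rw [map_add, map_smul, map_smul, hPu, hPv])
    rw [hTab, ← hN, ← sq_le_sq₀ (norm_nonneg _) (by positivity), mul_pow, hab,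
      norm_smul_add_smul_sq] at h2
    rw [hA, hB]
    linarith
  have hA0 : 0 ≤ A := by simpa using h1 1 0
  have hB0 : 0 ≤ B := by simpa using h1 0 1
  refine le_antisymm ?_ ?_
  · by_contra! hlt
    have hAB : 0 < A * B := lt_of_le_of_lt (sq_nonneg _) hlt
    have hA1 : 0 < A := pos_of_mul_pos_left hAB hB0
    have hB1 : 0 < B := pos_of_mul_pos_right hAB hA0
    set ε := (A * B - ‖c‖ ^ 2) / (A + B) with hε
    have hε0 : 0 < ε := div_pos (by linarith) (by linarith)
    have hεm : ε * (A + B) = A * B - ‖c‖ ^ 2 := div_mul_cancel₀ _ (by linarith)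
    have hεA : ε < A := by nlinarith [sq_nonneg ‖c‖]
    have hεB : ε < B := by nlinarith [sq_nonneg ‖c‖]
    have hNε : 0 ≤ N ^ 2 - ε := by nlinarith [sq_nonneg ‖y‖]
    have h3 : N ≤ Real.sqrt (N ^ 2 - ε) := by
      refine hP.norm_corner_le T (Real.sqrt_nonneg _) fun x hx => ?_
      obtain ⟨a, b, rfl⟩ := hmem x hx
      rw [← sq_le_sq₀ (norm_nonneg _) (by positivity), mul_pow, Real.sq_sqrt hNε, hab, hTab,
        norm_smul_add_smul_sq]
      have h4 : (star a * b * c).re ≤ ‖a‖ * ‖b‖ * ‖c‖ := by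
        refine (Complex.re_le_norm _).trans ?_
        rw [norm_mul, norm_mul, norm_star]
      have h5 : ‖c‖ ^ 2 ≤ (A - ε) * (B - ε) := by nlinarith [sq_nonneg ε]
      have h6 : ‖c‖ ≤ Real.sqrt (A - ε) * Real.sqrt (B - ε) := by
        rw [← Real.sqrt_mul (by linarith)]
        exact Real.le_sqrt_of_sq_le h5
      have h7 := Real.sq_sqrt (show 0 ≤ A - ε by linarith)
      have h8 := Real.sq_sqrt (show 0 ≤ B - ε by linarith)
      have h9 : ‖a‖ * ‖b‖ * ‖c‖ ≤ ‖a‖ * ‖b‖ * (Real.sqrt (A - ε) * Real.sqrt (B - ε)) := by gcongr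
      have h10 := sq_nonneg (Real.sqrt (A - ε) * ‖a‖ - Real.sqrt (B - ε) * ‖b‖)
      have h11 : (A - ε) * ‖a‖ ^ 2 + (B - ε) * ‖b‖ ^ 2 -
          2 * (‖a‖ * ‖b‖ * (Real.sqrt (A - ε) * Real.sqrt (B - ε))) =
          (Real.sqrt (A - ε) * ‖a‖ - Real.sqrt (B - ε) * ‖b‖) ^ 2 := by
        rw [sub_sq, mul_pow, mul_pow, h7, h8]; ring
      rw [hA, hB] at h11
      nlinarith
    have h4 : N ^ 2 ≤ N ^ 2 - ε := by
      rw [← Real.sq_sqrt hNε]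
      gcongr
    linarith
  · have h3 : ∀ t : ℝ, 0 ≤ B * (t * t) + (-(2 * ‖c‖ ^ 2)) * t + A * ‖c‖ ^ 2 := fun t => by
      have h4 := h1 c t
      have h5 : star c * t * c = ((‖c‖ ^ 2 * t : ℝ) : ℂ) := by
        rw [mul_right_comm, RCLike.star_def, Complex.conj_mul']
        push_cast
        ring
      rw [h5, Complex.ofReal_re, Complex.norm_real, Real.norm_eq_abs, sq_abs] at h4
      linarith
    have h4 := discrim_le_zero h3
    rw [discrim] at h4
    rcases (sq_nonneg ‖c‖).eq_or_lt with h0 | h0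
    · rw [← h0]; positivity
    · refine le_of_mul_le_mul_left ?_ h0
      nlinarith

theorem exists_proj_pair {u v : H} (hu : ‖u‖ = 1) (hv : ‖v‖ = 1) (huv : inner ℂ u v = 0) :
    ∃ P : H →L[ℂ] H, IsOrthoProj P ∧ P u = u ∧ P v = v ∧
      (∀ x, P x = x → ∃ a b : ℂ, x = a • u + b • v) ∧
      ∀ x, P x = inner ℂ u x • u + inner ℂ v x • v := by
  have hvu : inner ℂ v u = 0 := by rw [← inner_conj_symm, huv, map_zero]
  set K : Submodule ℂ H := Submodule.span ℂ {u, v} with hK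
  have huK : u ∈ K := Submodule.subset_span (by simp)
  have hvK : v ∈ K := Submodule.subset_span (by simp)
  have : FiniteDimensional ℂ K := FiniteDimensional.span_of_finite ℂ (by simp)
  refine ⟨K.starProjection, isOrthoProj_starProjection K,
    Submodule.starProjection_eq_self_iff.2 huK, Submodule.starProjection_eq_self_iff.2 hvK,
    fun x hx => ?_, fun x => ?_⟩
  · obtain ⟨a, b, h⟩ := Submodule.mem_span_pair.1 (Submodule.starProjection_eq_self_iff.1 hx)
    exact ⟨a, b, h.symm⟩
  · refine Submodule.eq_starProjection_of_mem_of_inner_eq_zero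
      (K.add_mem (K.smul_mem _ huK) (K.smul_mem _ hvK)) fun w hw => ?_
    obtain ⟨a, b, rfl⟩ := Submodule.mem_span_pair.1 hw
    simp only [inner_sub_left, inner_add_left, inner_add_right, inner_smul_left, inner_smul_right,
      inner_self_eq_norm_sq_to_K, hu, hv, huv, hvu, inner_conj_symm]
    simp

/-- The determinant of the Gram matrix of the corner of an operator with matrix `a`, `b`, `c`, `d`
on a two-dimensional space, the images of whose basis vectors have Gram matrix
`p`, `q`, `r`. -/
noncomputable def cornerDet (a b c d : ℂ) (p q : ℝ) (r : ℂ) : ℝ :=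
  (p - ‖a‖ ^ 2 - ‖c‖ ^ 2) * (q - ‖b‖ ^ 2 - ‖d‖ ^ 2) - ‖r - star a * b - star c * d‖ ^ 2

theorem cornerDet_eq {u v : H} (hu : ‖u‖ = 1) (hv : ‖v‖ = 1) (huv : inner ℂ u v = 0)
    {P : H →L[ℂ] H} (hP : IsOrthoProj P) (hPu : P u = u) (hPv : P v = v)
    (hmem : ∀ x, P x = x → ∃ a b : ℂ, x = a • u + b • v)
    (hPx : ∀ x, P x = inner ℂ u x • u + inner ℂ v x • v) (T : H →L[ℂ] H) :
    cornerDet (inner ℂ u (T u)) (inner ℂ u (T v)) (inner ℂ v (T u)) (inner ℂ v (T v))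
      (‖T u‖ ^ 2) (‖T v‖ ^ 2) (inner ℂ (T u) (T v)) =
    ‖(1 - P) * T * P‖ ^ 2 * (‖T u‖ ^ 2 + ‖T v‖ ^ 2 - ‖inner ℂ u (T u)‖ ^ 2 -
      ‖inner ℂ u (T v)‖ ^ 2 - ‖inner ℂ v (T u)‖ ^ 2 - ‖inner ℂ v (T v)‖ ^ 2) -
      ‖(1 - P) * T * P‖ ^ 4 := by
  have h1 := norm_corner_pair hu hv huv hP hPu hPv hmem T
  have hn : ∀ x, ‖x - P x‖ ^ 2 = ‖x‖ ^ 2 - ‖inner ℂ u x‖ ^ 2 - ‖inner ℂ v x‖ ^ 2 := fun x => by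
    have h2 := hP.norm_sq x
    rw [hPx x, norm_smul_add_smul_sq, huv, hu, hv, ← hPx x] at h2
    simp only [mul_zero, Complex.zero_re, one_pow, mul_one, add_zero] at h2
    linarith
  have hi : inner ℂ (T u - P (T u)) (T v - P (T v)) = inner ℂ (T u) (T v) -
      star (inner ℂ u (T u)) * inner ℂ u (T v) - star (inner ℂ v (T u)) * inner ℂ v (T v) := by
    have h3 : inner ℂ (P (T u)) (T v - P (T v)) = 0 := by
      rw [hP.inner_left, map_sub, hP.apply_apply, sub_self, inner_zero_right]
    rw [inner_sub_left, h3, sub_zero, inner_sub_right, hPx (T v), inner_add_right,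
      inner_smul_right, inner_smul_right, ← inner_conj_symm (T u) u, ← inner_conj_symm (T u) v,
      RCLike.star_def]
    ring
  rw [hi, hn, hn] at h1
  rw [cornerDet]
  linarith

theorem HasCN.cornerDet_eq {T : H →L[ℂ] H} (hT : HasCN T) {u v : H} (hu : ‖u‖ = 1) (hv : ‖v‖ = 1)
    (huv : inner ℂ u v = 0) :
    cornerDet (inner ℂ u (T u)) (inner ℂ u (T v)) (inner ℂ v (T u)) (inner ℂ v (T v))
      (‖T u‖ ^ 2) (‖T v‖ ^ 2) (inner ℂ (T u) (T v)) =
    cornerDet (star (inner ℂ u (T u))) (star (inner ℂ v (T u))) (star (inner ℂ u (T v)))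
      (star (inner ℂ v (T v))) (‖T u‖ ^ 2) (‖T v‖ ^ 2) (inner ℂ (T u) (T v)) := by
  obtain ⟨P, hP, hPu, hPv, hmem, hPx⟩ := exists_proj_pair hu hv huv
  have h1 := _root_.cornerDet_eq hu hv huv hP hPu hPv hmem hPx T
  have h2 := _root_.cornerDet_eq hu hv huv hP hPu hPv hmem hPx (adjoint T)
  have hn := isStarNormal_iff_norm_eq_adjoint.1 hT.isStarNormal
  have hs : ∀ x y, inner ℂ x (adjoint T y) = star (inner ℂ y (T x)) := fun x y => by
    rw [adjoint_inner_right, RCLike.star_def, inner_conj_symm]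
  have hc : inner ℂ (adjoint T u) (adjoint T v) = inner ℂ (T u) (T v) := by
    have h3 : T (adjoint T v) = adjoint T (T v) :=
      congrArg (fun B : H →L[ℂ] H => B v) hT.isStarNormal.star_comm_self.eq.symm
    rw [adjoint_inner_left, h3, adjoint_inner_right]
  rw [hs, hs, hs, hs, hc, ← hn, ← hn, hT.norm_corner_adjoint hP] at h2
  rw [h1, h2]
  simp only [norm_star]
  ring

omit [CompleteSpace H] in
theorem inner_sum_smul_of_orthogonal {ι : Type*} [Fintype ι] {x y : ι → H}
    (h : ∀ i j, i ≠ j → inner ℂ (x i) (y j) = 0) (p q : ι → ℂ) :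
    inner ℂ (∑ i, p i • x i) (∑ i, q i • y i) = ∑ i, star (p i) * q i * inner ℂ (x i) (y i) := by
  classical
  rw [sum_inner]
  refine Finset.sum_congr rfl fun i _ => ?_
  rw [inner_sum, Finset.sum_eq_single i]
  · rw [inner_smul_left, inner_smul_right, mul_assoc]; rfl
  · intro j _ hj
    rw [inner_smul_left, inner_smul_right, h i j hj.symm, mul_zero, mul_zero]
  · simp

omit [CompleteSpace H] in
theorem norm_sum_smul_sq_of_orthogonal {ι : Type*} [Fintype ι] {x : ι → H}
    (h : ∀ i j, i ≠ j → inner ℂ (x i) (x j) = 0) (p : ι → ℂ) :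
    ‖∑ i, p i • x i‖ ^ 2 = ∑ i, ‖p i‖ ^ 2 * ‖x i‖ ^ 2 := by
  have h1 := inner_sum_smul_of_orthogonal h p p
  simp only [inner_self_eq_norm_sq_to_K, RCLike.star_def, Complex.conj_mul',
    Complex.coe_algebraMap] at h1
  exact_mod_cast h1

/-- The corner determinant at the space spanned by `∑ i, p i • e i` and `∑ i, q i • e i`, where
`inner (e i) (T (e i)) = m i` and `‖T (e i)‖ = n i`. -/
noncomputable def diagDet (m : Fin 4 → ℂ) (n : Fin 4 → ℝ) : ℝ :=
  cornerDet ((m 0 + m 1 + m 2 + m 3) / 4)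
    ((m 0 - m 1 + 7 * Complex.I * m 2 - 7 * Complex.I * m 3) / 20)
    ((m 0 - m 1 - 7 * Complex.I * m 2 + 7 * Complex.I * m 3) / 20)
    ((m 0 + m 1 + 49 * m 2 + 49 * m 3) / 100)
    ((n 0 ^ 2 + n 1 ^ 2 + n 2 ^ 2 + n 3 ^ 2) / 4)
    ((n 0 ^ 2 + n 1 ^ 2 + 49 * n 2 ^ 2 + 49 * n 3 ^ 2) / 100)
    ((n 0 ^ 2 - n 1 ^ 2 + 7 * Complex.I * n 2 ^ 2 - 7 * Complex.I * n 3 ^ 2) / 20)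

theorem HasCN.diagDet_eq {T : H →L[ℂ] H} (hT : HasCN T) {e : Fin 4 → H} (he : ∀ i, ‖e i‖ = 1)
    (hee : ∀ i j, i ≠ j → inner ℂ (e i) (e j) = 0)
    (heT : ∀ i j, i ≠ j → inner ℂ (e i) (T (e j)) = 0)
    (hTT : ∀ i j, i ≠ j → inner ℂ (T (e i)) (T (e j)) = 0) :
    diagDet (fun i => inner ℂ (e i) (T (e i))) (fun i => ‖T (e i)‖) =
      diagDet (fun i => star (inner ℂ (e i) (T (e i)))) (fun i => ‖T (e i)‖) := by
  set p : Fin 4 → ℂ := ![1 / 2, 1 / 2, 1 / 2, 1 / 2] with hp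
  set q : Fin 4 → ℂ := ![1 / 10, -1 / 10, 7 * Complex.I / 10, -7 * Complex.I / 10] with hq
  set u := ∑ i, p i • e i with hu
  set v := ∑ i, q i • e i with hv
  have hTu : T u = ∑ i, p i • T (e i) := by rw [hu, map_sum]; simp only [map_smul]
  have hTv : T v = ∑ i, q i • T (e i) := by rw [hv, map_sum]; simp only [map_smul]
  have hu1 : ‖u‖ = 1 := by
    have h1 := norm_sum_smul_sq_of_orthogonal hee p
    rw [← hu] at h1
    rw [← sq_eq_sq₀ (norm_nonneg _) zero_le_one, h1]
    simp [he, Fin.sum_univ_four, hp]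
    norm_num
  have hv1 : ‖v‖ = 1 := by
    have h1 := norm_sum_smul_sq_of_orthogonal hee q
    rw [← hv] at h1
    rw [← sq_eq_sq₀ (norm_nonneg _) zero_le_one, h1]
    simp [he, Fin.sum_univ_four, hq]
    norm_num
  have huv : inner ℂ u v = 0 := by
    rw [hu, hv, inner_sum_smul_of_orthogonal hee]
    simp [he, Fin.sum_univ_four, hp, hq, inner_self_eq_norm_sq_to_K]
    ring
  have h := hT.cornerDet_eq hu1 hv1 huv
  have hTu2 : ‖T u‖ ^ 2 = (‖T (e 0)‖ ^ 2 + ‖T (e 1)‖ ^ 2 + ‖T (e 2)‖ ^ 2 + ‖T (e 3)‖ ^ 2) / 4 := by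
    rw [hTu, norm_sum_smul_sq_of_orthogonal hTT]
    simp [Fin.sum_univ_four, hp]
    ring
  have hTv2 : ‖T v‖ ^ 2 =
      (‖T (e 0)‖ ^ 2 + ‖T (e 1)‖ ^ 2 + 49 * ‖T (e 2)‖ ^ 2 + 49 * ‖T (e 3)‖ ^ 2) / 100 := by
    rw [hTv, norm_sum_smul_sq_of_orthogonal hTT]
    simp [Fin.sum_univ_four, hq]
    ring
  rw [hTu2, hTv2, hTu, hTv, hu, hv, inner_sum_smul_of_orthogonal hTT,
    inner_sum_smul_of_orthogonal heT, inner_sum_smul_of_orthogonal heT,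
    inner_sum_smul_of_orthogonal heT, inner_sum_smul_of_orthogonal heT] at h
  simp only [Fin.sum_univ_four, inner_self_eq_norm_sq_to_K] at h
  rw [diagDet, diagDet]
  have hI : Complex.I * Complex.I = -1 := Complex.I_mul_I
  convert h using 2 <;> simp [hp, hq] <;> ring_nf <;> simp [Complex.I_sq] <;> ring

theorem diagDet_sub (l : Fin 4 → ℂ) :
    diagDet l (fun i => ‖l i‖) - diagDet (fun i => star (l i)) (fun i => ‖l i‖) =
      -(21 / 625) * ((l 0 - l 3) * (l 1 - l 2) * star ((l 0 - l 1) * (l 3 - l 2))).im := by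
  have h : ∀ z : ℂ, ‖z‖ ^ 2 = z.re * z.re + z.im * z.im := fun z => by
    rw [← Complex.normSq_eq_norm_sq, Complex.normSq_apply]
  simp only [diagDet, cornerDet, ← Complex.ofReal_pow, h]
  generalize l 0 = a
  generalize l 1 = b
  generalize l 2 = c
  generalize l 3 = d
  obtain ⟨a, a'⟩ := a
  obtain ⟨b, b'⟩ := b
  obtain ⟨c, c'⟩ := c
  obtain ⟨d, d'⟩ := d
  simp
  ring

/-- A bump function of radius `δ` around `l`. -/
noncomputable def spectralBump (l : ℂ) (δ : ℝ) (z : ℂ) : ℂ := (max 0 (1 - ‖z - l‖ / δ) : ℝ)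

@[fun_prop]
theorem continuous_spectralBump (l : ℂ) (δ : ℝ) : Continuous (spectralBump l δ) := by
  unfold spectralBump
  fun_prop

theorem star_spectralBump (l : ℂ) (δ : ℝ) (z : ℂ) :
    star (spectralBump l δ z) = spectralBump l δ z := Complex.conj_ofReal _

theorem spectralBump_eq_zero {l : ℂ} {δ : ℝ} (hδ : 0 < δ) {z : ℂ} (h : δ ≤ ‖z - l‖) :
    spectralBump l δ z = 0 := by
  rw [spectralBump, max_eq_left, Complex.ofReal_zero]
  rwa [sub_nonpos, one_le_div hδ]

theorem spectralBump_mul_spectralBump {l m : ℂ} {δ : ℝ} (hδ : 0 < δ) (h : 2 * δ ≤ ‖l - m‖) (z : ℂ) :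
    spectralBump l δ z * spectralBump m δ z = 0 := by
  rcases le_or_gt δ ‖z - l‖ with h1 | h1
  · rw [spectralBump_eq_zero hδ h1, zero_mul]
  · rw [spectralBump_eq_zero (l := m) hδ, mul_zero]
    have h2 := norm_sub_le_norm_sub_add_norm_sub l z m
    rw [norm_sub_rev l z] at h2
    linarith

theorem cfc_spectralBump_mul_mul {T : H →L[ℂ] H} [IsStarNormal T] {l m : ℂ} {δ : ℝ}
    (hδ : 0 < δ) (h : 2 * δ ≤ ‖l - m‖) {g : ℂ → ℂ} (hg : Continuous g) :
    cfc (spectralBump l δ) T * cfc g T * cfc (spectralBump m δ) T = 0 := by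
  rw [← cfc_mul .., ← cfc_mul .., ← cfc_zero ℂ T]
  refine cfc_congr fun z _ => ?_
  simp only [Pi.zero_apply]
  rw [mul_right_comm, spectralBump_mul_spectralBump hδ h, zero_mul]

theorem adjoint_cfc_spectralBump (T : H →L[ℂ] H) (l : ℂ) (δ : ℝ) :
    adjoint (cfc (spectralBump l δ) T) = cfc (spectralBump l δ) T := by
  rw [← star_eq_adjoint, ← cfc_star]
  simp only [star_spectralBump]

theorem norm_apply_cfc_spectralBump_le {T : H →L[ℂ] H} (hT : IsStarNormal T) (l : ℂ) {δ : ℝ}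
    (hδ : 0 < δ) (y : H) :
    ‖T (cfc (spectralBump l δ) T y) - l • cfc (spectralBump l δ) T y‖ ≤
      δ * ‖cfc (spectralBump l δ) T y‖ := by
  set F := cfc (spectralBump l δ) T with hF
  set N := cfc (fun z => (Real.sqrt (δ ^ 2 - ‖z - l‖ ^ 2) : ℂ) * spectralBump l δ z) T with hN
  set R := cfc (fun z => (z - l) * spectralBump l δ z) T with hR
  have hRF : R = (T - l • 1) * F := by
    rw [hR, cfc_mul .., cfc_sub .., cfc_id' .., cfc_const .., Algebra.algebraMap_eq_smul_one]
  have h1 : star N * N + star R * R = ((δ ^ 2 : ℝ) : ℂ) • (star F * F) := by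
    rw [hN, hR, hF, ← cfc_star, ← cfc_star, ← cfc_star, ← cfc_mul .., ← cfc_mul .., ← cfc_mul ..,
      ← cfc_add .., ← cfc_smul ..]
    refine cfc_congr fun z _ => ?_
    simp only [star_mul, star_spectralBump, smul_eq_mul]
    rcases le_or_gt δ ‖z - l‖ with h1 | h1
    · rw [spectralBump_eq_zero hδ h1]; simp
    · have h2 := Real.mul_self_sqrt (show 0 ≤ δ ^ 2 - ‖z - l‖ ^ 2 by nlinarith [norm_nonneg (z - l)])
      have h3 : star (z - l) * (z - l) = ((‖z - l‖ ^ 2 : ℝ) : ℂ) := by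
        rw [RCLike.star_def, Complex.conj_mul']; push_cast; rfl
      have h4 : (Real.sqrt (δ ^ 2 - ‖z - l‖ ^ 2) : ℂ) * Real.sqrt (δ ^ 2 - ‖z - l‖ ^ 2) =
          ((δ ^ 2 - ‖z - l‖ ^ 2 : ℝ) : ℂ) := by exact_mod_cast h2
      simp only [RCLike.star_def, Complex.conj_ofReal] at h3 ⊢
      push_cast at h3 h4 ⊢
      linear_combination (spectralBump l δ z) ^ 2 * h3 + (spectralBump l δ z) ^ 2 * h4
  have h2 : adjoint N (N y) + adjoint R (R y) = ((δ ^ 2 : ℝ) : ℂ) • adjoint F (F y) :=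
    congrArg (fun B : H →L[ℂ] H => B y) h1
  have h3 := congrArg (fun x => (inner ℂ y x).re) h2
  simp only [inner_add_right, inner_smul_right, adjoint_inner_right, Complex.add_re,
    inner_self_eq_norm_sq_to_K, Complex.re_ofReal_mul, Complex.coe_algebraMap] at h3
  norm_cast at h3
  have h4 : T (F y) - l • F y = R y := by rw [hRF]; rfl
  rw [h4, ← sq_le_sq₀ (norm_nonneg _) (by positivity), mul_pow]
  nlinarith [sq_nonneg ‖N y‖]

theorem cfc_spectralBump_ne_zero {T : H →L[ℂ] H} (hT : IsStarNormal T) {l : ℂ}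
    (hl : l ∈ spectrum ℂ T) (δ : ℝ) : cfc (spectralBump l δ) T ≠ 0 := by
  intro h
  have h1 : (1 : ℂ) ∈ spectrum ℂ (cfc (spectralBump l δ) T) := by
    rw [cfc_map_spectrum (spectralBump l δ) T]
    exact ⟨l, hl, by simp [spectralBump]⟩
  rw [h] at h1
  cases subsingleton_or_nontrivial H
  · simp [spectrum.of_subsingleton] at h1
  · rw [spectrum.zero_eq] at h1
    simp at h1

theorem exists_approx_eigenvectors {T : H →L[ℂ] H} (hT : IsStarNormal T) {ι : Type*} {l : ι → ℂ}
    (hl : ∀ i, l i ∈ spectrum ℂ T) {δ : ℝ} (hδ : 0 < δ)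
    (hd : ∀ i j, i ≠ j → 2 * δ ≤ ‖l i - l j‖) :
    ∃ e : ι → H, (∀ i, ‖e i‖ = 1) ∧ (∀ i j, i ≠ j → inner ℂ (e i) (e j) = 0) ∧
      (∀ i j, i ≠ j → inner ℂ (e i) (T (e j)) = 0) ∧
      (∀ i j, i ≠ j → inner ℂ (T (e i)) (T (e j)) = 0) ∧ ∀ i, ‖T (e i) - l i • e i‖ ≤ δ := by
  set F : ι → H →L[ℂ] H := fun i => cfc (spectralBump (l i) δ) T
  have hF0 : ∀ i, ∃ y, F i y ≠ 0 := fun i => by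
    by_contra! h
    exact cfc_spectralBump_ne_zero hT (hl i) δ (ContinuousLinearMap.ext h)
  choose y hy using hF0
  have h0 : ∀ i j, i ≠ j → ∀ g : ℂ → ℂ, Continuous g → ∀ x z,
      inner ℂ (F i x) (cfc g T (F j z)) = 0 := fun i j hij g hg x z => by
    change inner ℂ (cfc (spectralBump (l i) δ) T x) _ = 0
    rw [← adjoint_cfc_spectralBump, adjoint_inner_left]
    have h1 : F i (cfc g T (F j z)) = 0 :=
      congrArg (fun B : H →L[ℂ] H => B z) (cfc_spectralBump_mul_mul hδ (hd i j hij) hg)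
    rw [h1, inner_zero_right]
  refine ⟨fun i => (‖F i (y i)‖⁻¹ : ℂ) • F i (y i), fun i => norm_smul_inv_norm (hy i),
    fun i j hij => ?_, fun i j hij => ?_, fun i j hij => ?_, fun i => ?_⟩
  · have h1 := h0 i j hij (fun _ => 1) continuous_const (y i) (y j)
    rw [cfc_const_one ℂ T] at h1
    change inner ℂ (F i (y i)) (F j (y j)) = 0 at h1
    rw [inner_smul_left, inner_smul_right, h1, mul_zero, mul_zero]
  · have h1 := h0 i j hij (fun z => z) continuous_id (y i) (y j)
    rw [cfc_id' ℂ T] at h1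
    rw [map_smul, inner_smul_left, inner_smul_right, h1, mul_zero, mul_zero]
  · have h1 := h0 i j hij (fun z => star z * z) (by fun_prop) (y i) (y j)
    rw [cfc_mul .., cfc_star .., cfc_id' ℂ T, star_eq_adjoint] at h1
    change inner ℂ (F i (y i)) (adjoint T (T (F j (y j)))) = 0 at h1
    rw [adjoint_inner_right] at h1
    rw [map_smul, map_smul, inner_smul_left, inner_smul_right, h1, mul_zero, mul_zero]
  · have h1 := norm_apply_cfc_spectralBump_le hT (l i) hδ (y i)
    have h2 : 0 < ‖F i (y i)‖ := norm_pos_iff.2 (hy i)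
    rw [map_smul, smul_comm, ← smul_sub, norm_smul, norm_inv, Complex.norm_real, norm_norm,
      inv_mul_le_iff₀ h2, mul_comm]
    exact h1

theorem HasCN.spectrum_cross_im_eq_zero {T : H →L[ℂ] H} (hT : HasCN T) {l : Fin 4 → ℂ}
    (hl : ∀ i, l i ∈ spectrum ℂ T) (hinj : Function.Injective l) :
    ((l 0 - l 3) * (l 1 - l 2) * star ((l 0 - l 1) * (l 3 - l 2))).im = 0 := by
  set Z : Set ((Fin 4 → ℂ) × (Fin 4 → ℝ)) :=
    {x | diagDet x.1 x.2 = diagDet (fun i => star (x.1 i)) x.2} with hZ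
  have hcl : IsClosed Z := by
    unfold Z diagDet cornerDet
    exact isClosed_eq (by fun_prop) (by fun_prop)
  have hmem : (l, fun i => ‖l i‖) ∈ closure Z := by
    rw [Metric.mem_closure_iff]
    intro ε hε
    obtain ⟨d, hd, hd'⟩ : ∃ d > 0, ∀ i j, i ≠ j → d ≤ ‖l i - l j‖ := by
      have hfin : (Set.univ : Set (Fin 4 × Fin 4)).Finite := Set.toFinite _
      have h1 : ∀ x : Fin 4 × Fin 4, ∃ d > 0, x.1 ≠ x.2 → d ≤ ‖l x.1 - l x.2‖ := fun x => by
        rcases eq_or_ne x.1 x.2 with h | h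
        · exact ⟨1, one_pos, fun h' => absurd h h'⟩
        · exact ⟨_, norm_pos_iff.2 (sub_ne_zero.2 (hinj.ne h)), fun _ => le_rfl⟩
      choose d hd hd' using h1
      refine ⟨Finset.univ.inf' Finset.univ_nonempty d, by simpa using fun a b => hd (a, b),
        fun i j hij => (Finset.inf'_le d (Finset.mem_univ (i, j))).trans (hd' (i, j) hij)⟩
    set δ := min (d / 2) (ε / 2) with hδ
    have hδ0 : 0 < δ := by positivity
    obtain ⟨e, he, hee, heT, hTT, hle⟩ := exists_approx_eigenvectors hT.isStarNormal hl hδ0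
      fun i j hij => by linarith [hd' i j hij, min_le_left (d / 2) (ε / 2)]
    refine ⟨(fun i => inner ℂ (e i) (T (e i)), fun i => ‖T (e i)‖),
      hT.diagDet_eq he hee heT hTT, ?_⟩
    have hδε : δ < ε := lt_of_le_of_lt (min_le_right _ _) (by linarith)
    rw [Prod.dist_eq, max_lt_iff, dist_pi_lt_iff hε, dist_pi_lt_iff hε]
    refine ⟨fun i => lt_of_le_of_lt ?_ hδε, fun i => lt_of_le_of_lt ?_ hδε⟩
    · have h1 : inner ℂ (e i) (T (e i)) - l i = inner ℂ (e i) (T (e i) - l i • e i) := by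
        rw [inner_sub_right, inner_smul_right, inner_self_eq_norm_sq_to_K, he]; simp
      rw [dist_comm, dist_eq_norm]
      simp only [h1]
      refine (norm_inner_le_norm _ _).trans ?_
      rw [he, one_mul]
      exact hle i
    · have h1 : ‖l i‖ = ‖l i • e i‖ := by rw [norm_smul, he, mul_one]
      rw [dist_comm, Real.dist_eq]
      simp only [h1]
      exact (abs_norm_sub_norm_le _ _).trans (hle i)
  rw [hcl.closure_eq] at hmem
  have h := diagDet_sub l
  rw [sub_eq_zero.2 hmem] at h
  simpa using h.symm

theorem exists_smul_one_add_smul_of_line {T : H →L[ℂ] H} (hT : IsStarNormal T) {a b : ℂ}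
    (hab : a ≠ b) (h : ∀ z ∈ spectrum ℂ T, ((a - z) * star (z - b)).im = 0) :
    ∃ (l m : ℂ) (L : H →L[ℂ] H), adjoint L = L ∧ T = l • 1 + m • L := by
  have hba : b - a ≠ 0 := sub_ne_zero.2 hab.symm
  refine ⟨a, b - a, cfc (fun z => (z - a) / (b - a)) T, ?_, ?_⟩
  · rw [← star_eq_adjoint, ← cfc_star]
    refine cfc_congr fun z hz => ?_
    have h1 := h z hz
    have h2 : (z - a) / (b - a) = ((z - a) * star (b - a)) * ((‖b - a‖ ^ 2 : ℝ) : ℂ)⁻¹ := by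
      rw [div_eq_mul_inv, Complex.inv_def, Complex.normSq_eq_norm_sq, mul_assoc]
      push_cast
      rfl
    simp only [h2]
    rw [RCLike.star_def, Complex.conj_eq_iff_im, ← Complex.ofReal_inv, Complex.im_mul_ofReal]
    have h3 : ((z - a) * star (b - a)).im = ((a - z) * star (z - b)).im := by
      simp; ring
    rw [← RCLike.star_def, h3, h1, zero_mul]
  · conv_lhs => rw [← cfc_id' ℂ T]
    rw [← Algebra.algebraMap_eq_smul_one, ← cfc_smul .., ← cfc_const_add ..]
    refine cfc_congr fun z _ => ?_
    simp only [smul_eq_mul]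
    field_simp
    ring

theorem exists_smul_one_add_smul_of_circle {T : H →L[ℂ] H} (hT : IsStarNormal T) {a : ℂ} {r : ℝ}
    (hr : 0 < r) (h : ∀ z ∈ spectrum ℂ T, ‖z - a‖ = r) :
    ∃ U : H →L[ℂ] H, adjoint U * U = 1 ∧ U * adjoint U = 1 ∧ T = a • 1 + (r : ℂ) • U := by
  have hr' : (r : ℂ) ≠ 0 := by exact_mod_cast hr.ne'
  have key : ∀ z ∈ spectrum ℂ T, star ((z - a) / r) * ((z - a) / r) = 1 := fun z hz => by
    rw [RCLike.star_def, Complex.conj_mul', norm_div, h z hz, Complex.norm_real,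
      Real.norm_of_nonneg hr.le, div_self hr.ne']
    simp
  refine ⟨cfc (fun z => (z - a) / r) T, ?_, ?_, ?_⟩
  · rw [← star_eq_adjoint, ← cfc_star, ← cfc_mul .., ← cfc_const_one ℂ T]
    exact cfc_congr key
  · rw [← star_eq_adjoint, ← cfc_star, ← cfc_mul .., ← cfc_const_one ℂ T]
    exact cfc_congr fun z hz => by rw [← key z hz, mul_comm]
  · conv_lhs => rw [← cfc_id' ℂ T]
    rw [← Algebra.algebraMap_eq_smul_one, ← cfc_smul .., ← cfc_const_add ..]
    refine cfc_congr fun z _ => ?_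
    simp only [smul_eq_mul]
    field_simp
    ring

/-- A point whose cross-ratio with three non-collinear points is real lies on their circle. -/
theorem norm_sub_eq_of_cross_im_eq_zero {a b c z : ℂ} (hk : ((b - c) * star (a - b)).im ≠ 0)
    (h : ((a - z) * (b - c) * star ((a - b) * (z - c))).im = 0) :
    let k := (b - c) * star (a - b)
    let o := Complex.I * star (k * star c - star (k * a)) / (2 * k.im)
    ‖z - o‖ = ‖a - o‖ := by
  intro k o
  have hk' : ((k.im : ℝ) : ℂ) ≠ 0 := by exact_mod_cast hk
  have ho : 2 * k.im * o = Complex.I * star (k * star c - star (k * a)) := by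
    simp only [o]; field_simp
  have h1 : ((a - z) * k * star (z - c)).im = 0 := by
    rw [← h]
    simp only [k, star_mul]
    ring_nf
  rw [← sq_eq_sq₀ (norm_nonneg _) (norm_nonneg _), ← Complex.normSq_eq_norm_sq,
    ← Complex.normSq_eq_norm_sq, Complex.normSq_apply, Complex.normSq_apply]
  have h2 := congrArg Complex.re ho
  have h3 := congrArg Complex.im ho
  refine mul_left_cancel₀ hk ?_
  change k.im * _ = k.im * _
  clear_value k o
  simp at h1 h2 h3
  simp only [Complex.sub_re, Complex.sub_im]
  linear_combination -h1 + (a.re - z.re) * h2 + (a.im - z.im) * h3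

theorem HasCN.cross_im_eq_zero {T : H →L[ℂ] H} (hT : HasCN T) {a b c z : ℂ}
    (ha : a ∈ spectrum ℂ T) (hb : b ∈ spectrum ℂ T) (hc : c ∈ spectrum ℂ T)
    (hz : z ∈ spectrum ℂ T) (hab : a ≠ b) (hac : a ≠ c) (hbc : b ≠ c) :
    ((a - z) * (b - c) * star ((a - b) * (z - c))).im = 0 := by
  rcases eq_or_ne a z with rfl | haz
  · simp
  rcases eq_or_ne c z with rfl | hcz
  · simp
  rcases eq_or_ne b z with rfl | hbz
  · rw [RCLike.star_def, Complex.mul_conj, Complex.ofReal_im]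
  have := hT.spectrum_cross_im_eq_zero (l := ![a, b, c, z])
    (by intro i; fin_cases i <;> assumption)
    (by
      intro i j hij
      fin_cases i <;> fin_cases j <;> simp_all)
  simpa using this

theorem HasCN.line_or_circle [Nontrivial H] {T : H →L[ℂ] H} (hT : HasCN T) :
    (∃ (l m : ℂ) (L : H →L[ℂ] H), adjoint L = L ∧ T = l • 1 + m • L) ∨
    ∃ (l m : ℂ) (U : H →L[ℂ] H), m ≠ 0 ∧ adjoint U * U = 1 ∧ U * adjoint U = 1 ∧
      T = l • 1 + m • U := by
  have hn := hT.isStarNormal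
  obtain ⟨a, ha⟩ := spectrum.nonempty T
  by_cases h1 : ∀ z ∈ spectrum ℂ T, z = a
  · left
    refine exists_smul_one_add_smul_of_line hn (a := a) (b := a + 1) (by simp) fun z hz => ?_
    simp [h1 z hz]
  push Not at h1
  obtain ⟨b, hb, hba⟩ := h1
  by_cases h2 : ∀ z ∈ spectrum ℂ T, z = a ∨ z = b
  · left
    refine exists_smul_one_add_smul_of_line hn hba.symm fun z hz => ?_
    rcases h2 z hz with rfl | rfl <;> simp
  push Not at h2
  obtain ⟨c, hc, hca, hcb⟩ := h2
  have key := fun z hz => hT.cross_im_eq_zero (z := z) ha hb hc hz hba.symm hca.symm hcb.symm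
  by_cases hk : ((b - c) * star (a - b)).im = 0
  · left
    refine exists_smul_one_add_smul_of_line hn hca.symm fun z hz => ?_
    have hk0 : (b - c) * star (a - b) ≠ 0 :=
      mul_ne_zero (sub_ne_zero.2 hcb.symm) (star_ne_zero.2 (sub_ne_zero.2 hba.symm))
    have h3 := key z hz
    have h4 : (a - z) * (b - c) * star ((a - b) * (z - c)) =
        (((b - c) * star (a - b)).re : ℂ) * ((a - z) * star (z - c)) := by
      rw [Complex.conj_eq_iff_re.1 (Complex.conj_eq_iff_im.2 hk), star_mul]
      ring
    rw [h4, Complex.im_ofReal_mul] at h3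
    refine (mul_eq_zero.1 h3).resolve_left fun h5 => hk0 (Complex.ext h5 hk)
  · right
    have h3 := fun z hz => norm_sub_eq_of_cross_im_eq_zero hk (key z hz)
    set o := Complex.I * star ((b - c) * star (a - b) * star c - star ((b - c) * star (a - b) * a)) /
      (2 * ((b - c) * star (a - b)).im) with ho
    have hr : 0 < ‖a - o‖ := by
      rw [norm_pos_iff, sub_ne_zero]
      rintro h4
      have h5 := h3 b hb
      simp only [← ho, ← h4, sub_self, norm_zero, norm_eq_zero, sub_eq_zero] at h5
      exact hba h5
    obtain ⟨U, hU, hU', hTU⟩ := exists_smul_one_add_smul_of_circle hn hr h3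
    exact ⟨o, _, U, by simpa using hr.ne', hU, hU', hTU⟩

omit [CompleteSpace H] in
theorem norm_sum_smul_le_of_orthonormal {f d : ℕ → H} (hf : Orthonormal ℂ f) {ε : ℝ}
    (hd : ∀ s : Finset ℕ, ∑ n ∈ s, ‖d n‖ ≤ ε) (s : Finset ℕ) (a : ℕ → ℂ) :
    ‖∑ n ∈ s, a n • d n‖ ≤ ε * ‖∑ n ∈ s, a n • f n‖ := by
  set x := ∑ n ∈ s, a n • f n with hx
  have h1 : ∀ n ∈ s, ‖a n‖ ≤ ‖x‖ := fun n hn => by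
    rw [← hf.inner_right_sum a hn]
    refine (norm_inner_le_norm _ _).trans ?_
    rw [hf.1, one_mul]
  calc ‖∑ n ∈ s, a n • d n‖ ≤ ∑ n ∈ s, ‖a n • d n‖ := norm_sum_le _ _
    _ ≤ ∑ n ∈ s, ‖x‖ * ‖d n‖ := Finset.sum_le_sum fun n hn => by
        rw [norm_smul]; gcongr; exact h1 n hn
    _ = ‖x‖ * ∑ n ∈ s, ‖d n‖ := by rw [Finset.mul_sum]
    _ ≤ ‖x‖ * ε := by gcongr; exact hd s
    _ = ε * ‖x‖ := mul_comm _ _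

/-- A unitary operator which, compressed to the closed span of an orthonormal sequence, is close
to a multiple of the unilateral shift does not have property (CN). -/
theorem not_hasCN_of_shift {U : H →L[ℂ] H} (h₁ : adjoint U * U = 1) (h₂ : U * adjoint U = 1)
    {f g : ℕ → H} (hf : Orthonormal ℂ f) {r ε : ℝ} (hε : 2 * ε < r) (hε0 : 0 ≤ ε) (hr1 : r ≤ 1)
    (hfg : ∀ m n, inner ℂ (f m) (g n) = if m = n + 1 then (r : ℂ) else 0)
    (hd : ∀ s : Finset ℕ, ∑ n ∈ s, ‖U (f n) - g n‖ ≤ ε) : ¬ HasCN U := by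
  intro hU
  set K : Submodule ℂ H := (Submodule.span ℂ (Set.range f)).topologicalClosure with hK
  have : CompleteSpace K := (Submodule.isClosed_topologicalClosure _).completeSpace_coe
  set P := K.starProjection with hPdef
  have hP : IsOrthoProj P := isOrthoProj_starProjection K
  have hspan : Submodule.span ℂ (Set.range f) ≤ K := Submodule.le_topologicalClosure _
  have hfK : ∀ n, f n ∈ K := fun n => hspan (Submodule.subset_span ⟨n, rfl⟩)
  have hPf : ∀ n, P (f n) = f n := fun n => Submodule.starProjection_eq_self_iff.2 (hfK n)
  have hclosed : ∀ {S : Set H}, IsClosed S → (∀ (s : Finset ℕ) (a : ℕ → ℂ),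
      ∑ n ∈ s, a n • f n ∈ S) → ∀ x ∈ K, x ∈ S := fun {S} hS h x hx => by
    refine closure_minimal (fun y hy => ?_) hS hx
    obtain ⟨c, rfl⟩ := Finsupp.mem_span_range_iff_exists_finsupp.1 hy
    exact h c.support c
  have hPg : ∀ n, P (g n) = (r : ℂ) • f (n + 1) := fun n => by
    refine Submodule.eq_starProjection_of_mem_of_inner_eq_zero (K.smul_mem _ (hfK _))
      (hclosed (isClosed_eq (by fun_prop) continuous_const) fun s a => ?_)
    have h0 : ∀ m, inner ℂ (f m) (g n - (r : ℂ) • f (n + 1)) = 0 := fun m => by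
      rw [inner_sub_right, inner_smul_right, hfg, orthonormal_iff_ite.1 hf]
      split_ifs <;> simp
    refine inner_eq_zero_symm.1 ?_
    rw [sum_inner]
    exact Finset.sum_eq_zero fun m _ => by rw [inner_smul_left, h0, mul_zero]
  have hdec : ∀ (s : Finset ℕ) (a : ℕ → ℂ), P (U (∑ n ∈ s, a n • f n)) =
      (r : ℂ) • ∑ n ∈ s, a n • f (n + 1) + P (∑ n ∈ s, a n • (U (f n) - g n)) := fun s a => by
    simp only [map_sum, map_smul, map_sub, hPg, Finset.smul_sum, ← Finset.sum_add_distrib]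
    refine Finset.sum_congr rfl fun n _ => ?_
    rw [smul_sub, smul_comm (r : ℂ)]
    abel
  have herr : ∀ (s : Finset ℕ) (a : ℕ → ℂ), ‖P (∑ n ∈ s, a n • (U (f n) - g n))‖ ≤
      ε * ‖∑ n ∈ s, a n • f n‖ := fun s a =>
    (hP.norm_apply_le _).trans (norm_sum_smul_le_of_orthonormal hf hd s a)
  have hshift : ∀ (s : Finset ℕ) (a : ℕ → ℂ),
      ‖∑ n ∈ s, a n • f (n + 1)‖ = ‖∑ n ∈ s, a n • f n‖ := fun s a => by
    have hf' : Orthonormal ℂ fun n => f (n + 1) := hf.comp _ (add_left_injective 1)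
    have h3 := (hf'.inner_sum a a s).trans (hf.inner_sum a a s).symm
    simp only [inner_self_eq_norm_sq_to_K, Complex.coe_algebraMap] at h3
    rw [← sq_eq_sq₀ (norm_nonneg _) (norm_nonneg _)]
    exact_mod_cast h3
  have hlow : ∀ x ∈ K, (r - ε) * ‖x‖ ≤ ‖P (U x)‖ :=
    hclosed (S := {x | (r - ε) * ‖x‖ ≤ ‖P (U x)‖})
      (isClosed_le (by fun_prop) (by fun_prop)) fun s a => by
      have h3 := norm_sub_le_norm_add ((r : ℂ) • ∑ n ∈ s, a n • f (n + 1))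
        (P (∑ n ∈ s, a n • (U (f n) - g n)))
      rw [← hdec, norm_smul, hshift, Complex.norm_real, Real.norm_of_nonneg (by linarith)] at h3
      change _ ≤ ‖P (U (∑ n ∈ s, a n • f n))‖
      linarith [herr s a]
  have hup : ∀ x ∈ K, ‖inner ℂ x (adjoint U (f 0))‖ ≤ ε * ‖x‖ :=
    hclosed (S := {x | ‖inner ℂ x (adjoint U (f 0))‖ ≤ ε * ‖x‖})
      (isClosed_le (by fun_prop) (by fun_prop)) fun s a => by
      change ‖inner ℂ (∑ n ∈ s, a n • f n) (adjoint U (f 0))‖ ≤ _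
      rw [adjoint_inner_right, ← hPf 0, ← hP.inner_left, hdec, inner_add_left]
      have h3 : inner ℂ ((r : ℂ) • ∑ n ∈ s, a n • f (n + 1)) (f 0) = 0 := by
        rw [inner_smul_left, sum_inner]
        refine mul_eq_zero_of_right _ (Finset.sum_eq_zero fun n _ => ?_)
        rw [inner_smul_left, hf.2 (Nat.succ_ne_zero n), mul_zero]
      rw [h3, zero_add]
      refine (norm_inner_le_norm _ _).trans ?_
      rw [hf.1, mul_one]
      exact herr s a
  have hcorner : ‖(1 - P) * U * P‖ ≤ Real.sqrt (1 - (r - ε) ^ 2) := by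
    have hnn : 0 ≤ 1 - (r - ε) ^ 2 := by nlinarith
    refine hP.norm_corner_le U (Real.sqrt_nonneg _) fun x hx => ?_
    have h3 := hlow x (Submodule.starProjection_eq_self_iff.1 hx)
    have h4 := hP.norm_sq (U x)
    rw [norm_apply_of_adjoint_mul_eq_one h₁] at h4
    rw [← sq_le_sq₀ (norm_nonneg _) (by positivity), mul_pow, Real.sq_sqrt hnn]
    rw [← sq_le_sq₀ (mul_nonneg (by linarith) (norm_nonneg _)) (norm_nonneg _), mul_pow] at h3
    linarith
  have hcorner' := corner_apply_le (adjoint U) (hPf 0)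
  rw [hU.norm_corner_adjoint hP, hf.1, mul_one] at hcorner'
  have h3 := hP.norm_sq (adjoint U (f 0))
  rw [norm_adjoint_apply_of_mul_adjoint_eq_one h₂, hf.1] at h3
  have h4 : ‖P (adjoint U (f 0))‖ ≤ ε := by
    have h5 := hup (P (adjoint U (f 0))) (Submodule.starProjection_apply_mem _ _)
    have h6 : inner ℂ (P (adjoint U (f 0))) (adjoint U (f 0)) =
        inner ℂ (P (adjoint U (f 0))) (P (adjoint U (f 0))) := by
      rw [← hP.apply_apply, hP.inner_left, hP.apply_apply]
    rw [h6, inner_self_eq_norm_sq_to_K] at h5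
    simp only [norm_pow, Complex.coe_algebraMap, Complex.norm_real, norm_norm] at h5
    by_contra! h7
    nlinarith
  have h5 := hcorner'.trans hcorner
  have hnn : 0 ≤ 1 - (r - ε) ^ 2 := by nlinarith
  rw [← sq_le_sq₀ (norm_nonneg _) (by positivity), Real.sq_sqrt hnn] at h5
  have h6 : ‖P (adjoint U (f 0))‖ ^ 2 ≤ ε ^ 2 := by gcongr
  nlinarith

theorem exists_ball_subset_convexHull {E : Set ℂ} (h : ∀ w : ℂ, ‖w‖ = 1 → ∃ z ∈ E, (w * z).re < 0) :
    ∃ δ > 0, Metric.ball 0 δ ⊆ convexHull ℝ E := by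
  obtain ⟨F, hF, hFE, δ, hδ, h1⟩ : ∃ F : Set ℂ, F.Finite ∧ F ⊆ E ∧ ∃ δ > 0,
      ∀ w ∈ Metric.sphere (0 : ℂ) 1, ∃ z ∈ F, (w * z).re ≤ -δ := by
    refine (isCompact_sphere (0 : ℂ) 1).induction_on (p := fun S => ∃ F : Set ℂ, F.Finite ∧ F ⊆ E ∧
      ∃ δ > 0, ∀ w ∈ S, ∃ z ∈ F, (w * z).re ≤ -δ) ?_ ?_ ?_ ?_
    · exact ⟨∅, Set.finite_empty, Set.empty_subset _, 1, one_pos, by simp⟩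
    · rintro S S' hS ⟨F, hF, hFE, δ, hδ, h1⟩
      exact ⟨F, hF, hFE, δ, hδ, fun w hw => h1 w (hS hw)⟩
    · rintro S S' ⟨F, hF, hFE, δ, hδ, h1⟩ ⟨F', hF', hFE', δ', hδ', h1'⟩
      refine ⟨F ∪ F', hF.union hF', Set.union_subset hFE hFE', min δ δ', lt_min hδ hδ', ?_⟩
      rintro w (hw | hw)
      · obtain ⟨z, hz, hzw⟩ := h1 w hw
        exact ⟨z, Or.inl hz, hzw.trans (neg_le_neg (min_le_left _ _))⟩
      · obtain ⟨z, hz, hzw⟩ := h1' w hw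
        exact ⟨z, Or.inr hz, hzw.trans (neg_le_neg (min_le_right _ _))⟩
    · intro w hw
      obtain ⟨z, hz, hzw⟩ := h w (by simpa using hw)
      refine ⟨{v | (v * z).re < (w * z).re / 2}, mem_nhdsWithin_of_mem_nhds
        (IsOpen.mem_nhds (isOpen_lt (by fun_prop) continuous_const) ?_), {z}, Set.finite_singleton z,
        by simpa using hz, -(w * z).re / 2, by linarith, fun v hv => ⟨z, rfl, ?_⟩⟩
      · change (w * z).re < (w * z).re / 2
        linarith
      · have : (v * z).re < (w * z).re / 2 := hv
        linarith
  refine ⟨δ, hδ, fun x hx => convexHull_mono hFE ?_⟩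
  by_contra hxF
  obtain ⟨f, u, hfx, hfu⟩ := geometric_hahn_banach_point_closed (convex_convexHull ℝ F)
    (hF.isCompact_convexHull ℝ).isClosed hxF
  set c : ℂ := f 1 - f Complex.I * Complex.I with hc
  have hfc : ∀ z, f z = (c * z).re := fun z => by
    have h2 : z = z.re • (1 : ℂ) + z.im • Complex.I := by simp
    conv_lhs => rw [h2, map_add, map_smul, map_smul]
    simp [hc]
    ring
  have hc0 : c ≠ 0 := by
    rintro h0
    obtain ⟨z, hz, -⟩ := h1 1 (by simp)
    have h3 := hfu z (subset_convexHull ℝ F hz)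
    rw [hfc, h0, zero_mul] at hfx h3
    linarith
  have hcn : 0 < ‖c‖ := norm_pos_iff.2 hc0
  obtain ⟨z, hz, hzc⟩ := h1 ((‖c‖⁻¹ : ℝ) * c) (by simp [hcn.ne'])
  have h3 := hfu z (subset_convexHull ℝ F hz)
  rw [mul_assoc, Complex.re_ofReal_mul, ← hfc, inv_mul_le_iff₀ hcn] at hzc
  have h4 : -(‖c‖ * ‖x‖) ≤ f x := by
    rw [hfc, ← norm_mul]
    exact (abs_le.1 (Complex.abs_re_le_norm _)).1
  have h5 : ‖c‖ * ‖x‖ < ‖c‖ * δ := by gcongr; simpa using hx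
  linarith

/-- If a subset of the unit circle lies in no closed half-plane then the origin is the barycenter of
a probability measure on it whose second moment has modulus less than one. -/
theorem exists_barycenter {E : Set ℂ} (hE : ∀ z ∈ E, ‖z‖ = 1)
    (h : ∀ w : ℂ, ‖w‖ = 1 → ∃ z ∈ E, (w * z).re < 0) :
    ∃ (ι : Type) (_ : Fintype ι) (t : ι → ℝ) (z : ι → ℂ), (∀ i, 0 ≤ t i) ∧ ∑ i, t i = 1 ∧
      (∀ i, z i ∈ E) ∧ ∑ i, (t i : ℂ) * z i = 0 ∧ ‖∑ i, (t i : ℂ) * z i ^ 2‖ < 1 := by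
  obtain ⟨δ, hδ, hball⟩ := exists_ball_subset_convexHull h
  obtain ⟨p, hp, -⟩ := h 1 (by simp)
  obtain ⟨q, hq, hpq⟩ := h (Complex.I * star p) (by simp [hE p hp])
  set s := δ / 4 with hs
  have hs0 : 0 < s := by positivity
  have hmem : -(s : ℂ) * (p + q) ∈ convexHull ℝ E := hball (by
    rw [mem_ball_zero_iff, norm_mul, norm_neg, Complex.norm_real, Real.norm_of_nonneg hs0.le]
    have h1 := norm_add_le p q
    rw [hE p hp, hE q hq] at h1
    nlinarith)
  obtain ⟨ι, hι, t, z, ht, ht1, hz, hsum⟩ := mem_convexHull_iff_exists_fintype.1 hmem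
  have hS : 0 < 1 + 2 * s := by positivity
  have hS' : (1 + 2 * s : ℂ) ≠ 0 := by exact_mod_cast hS.ne'
  refine ⟨ι ⊕ Bool, inferInstance, Sum.elim (fun i => t i / (1 + 2 * s)) (fun _ => s / (1 + 2 * s)),
    Sum.elim z (fun b => if b then p else q), ?_, ?_, ?_, ?_, ?_⟩
  · rintro (i | b)
    · exact div_nonneg (ht i) hS.le
    · exact div_nonneg hs0.le hS.le
  · simp only [Fintype.sum_sum_type, Sum.elim_inl, Sum.elim_inr, Fintype.sum_bool]
    rw [← Finset.sum_div, ht1]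
    field_simp
    ring
  · rintro (i | b)
    · exact hz i
    · cases b <;> simpa
  · simp only [Fintype.sum_sum_type, Sum.elim_inl, Sum.elim_inr, Fintype.sum_bool]
    simp only [Complex.real_smul] at hsum
    have h1 : ∑ i, ((t i / (1 + 2 * s) : ℝ) : ℂ) * z i = (-(s : ℂ) * (p + q)) / (1 + 2 * s) := by
      rw [← hsum, Finset.sum_div]
      exact Finset.sum_congr rfl fun i _ => by push_cast; ring
    rw [h1]
    push_cast
    simp
    field_simp
    ring
  · simp only [Fintype.sum_sum_type, Sum.elim_inl, Sum.elim_inr, Fintype.sum_bool]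
    have hlt : ‖p ^ 2 + q ^ 2‖ < 2 := by
      have h1 : Complex.normSq (p ^ 2 + q ^ 2) = (Complex.normSq p + Complex.normSq q) ^ 2 -
          4 * (star p * q).im ^ 2 := by
        simp [Complex.normSq_apply, pow_two]
        ring
      have h2 : (star p * q).im ≠ 0 := by
        rw [mul_assoc, Complex.I_mul_re] at hpq
        linarith
      rw [Complex.normSq_eq_norm_sq, Complex.normSq_eq_norm_sq, Complex.normSq_eq_norm_sq, hE p hp,
        hE q hq] at h1
      rw [← sq_lt_sq₀ (norm_nonneg _) (by norm_num), h1]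
      have : 0 < (star p * q).im ^ 2 := by positivity
      linarith
    have h1 : ‖∑ i, ((t i / (1 + 2 * s) : ℝ) : ℂ) * z i ^ 2‖ ≤ 1 / (1 + 2 * s) := by
      have h0 : 1 / (1 + 2 * s) = ∑ i, t i / (1 + 2 * s) := by rw [← Finset.sum_div, ht1]
      rw [h0]
      refine norm_sum_le_of_le _ fun i _ => ?_
      rw [norm_mul, norm_pow, hE _ (hz i), Complex.norm_real,
        Real.norm_of_nonneg (div_nonneg (ht i) hS.le), one_pow, mul_one]
    have h2 : ‖((s / (1 + 2 * s) : ℝ) : ℂ) * p ^ 2 + ((s / (1 + 2 * s) : ℝ) : ℂ) * q ^ 2‖ <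
        s / (1 + 2 * s) * 2 := by
      rw [← mul_add, norm_mul, Complex.norm_real, Real.norm_of_nonneg (by positivity)]
      gcongr
    calc _ ≤ _ := norm_add_le _ _
      _ < 1 / (1 + 2 * s) + s / (1 + 2 * s) * 2 := by
        refine add_lt_add_of_le_of_lt h1 ?_
        simpa using h2
      _ = 1 := by field_simp

theorem exists_conj_mul_eq {t : ℝ} {w : ℂ} (h : 2 * ‖w‖ ≤ t) :
    ∃ x y : ℂ, star y * x = w ∧ ‖x‖ ^ 2 + ‖y‖ ^ 2 = t := by
  rcases (show 0 ≤ t by linarith [norm_nonneg w]).eq_or_lt with h0 | h0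
  · have : w = 0 := norm_le_zero_iff.1 (by linarith)
    exact ⟨0, 0, by simp [this], by simp [← h0]⟩
  · set d := Real.sqrt (t ^ 2 - 4 * ‖w‖ ^ 2) with hd
    have hd2 : d ^ 2 = t ^ 2 - 4 * ‖w‖ ^ 2 := Real.sq_sqrt (by nlinarith [norm_nonneg w])
    have hd0 : 0 ≤ d := Real.sqrt_nonneg _
    set b := Real.sqrt ((t + d) / 2) with hb
    have hb0 : 0 < b := Real.sqrt_pos.2 (by positivity)
    have hb2 : b ^ 2 = (t + d) / 2 := Real.sq_sqrt (by positivity)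
    have hb' : (b : ℂ) ≠ 0 := by exact_mod_cast hb0.ne'
    refine ⟨w / b, b, ?_, ?_⟩
    · rw [RCLike.star_def, Complex.conj_ofReal, mul_div_cancel₀ _ hb']
    · rw [norm_div, Complex.norm_real, Real.norm_of_nonneg hb0.le, div_pow,
        div_add' _ _ _ (by positivity), div_eq_iff (by positivity), hb2]
      nlinarith

omit [CompleteSpace H] in
theorem exists_approx_null_vector {A : H →L[ℂ] H} (hA : ¬ EssBoundedBelow A) (s : Finset H) {ε : ℝ}
    (hε : 0 < ε) : ∃ e : H, ‖e‖ = 1 ∧ (∀ x ∈ s, inner ℂ x e = 0) ∧ ‖A e‖ ≤ ε := by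
  have : FiniteDimensional ℂ (Submodule.span ℂ (s : Set H)) :=
    FiniteDimensional.span_of_finite ℂ s.finite_toSet
  by_contra! h
  refine hA ⟨Submodule.span ℂ (s : Set H), this, ε, hε, fun x hx => ?_⟩
  rcases eq_or_ne x 0 with rfl | hx0
  · simp
  have h1 := h ((‖x‖⁻¹ : ℂ) • x) (norm_smul_inv_norm hx0) fun y hy => by
    rw [inner_smul_right, hx y (Submodule.subset_span hy), mul_zero]
  rw [map_smul, norm_smul, norm_inv, Complex.norm_real, norm_norm,
    lt_inv_mul_iff₀ (norm_pos_iff.2 hx0)] at h1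
  linarith

omit [CompleteSpace H] in
theorem exists_orthonormal_approx_null {ι : Type*} [Countable ι] [Infinite ι] {A : ι → H →L[ℂ] H}
    (hA : ∀ i, ¬ EssBoundedBelow (A i)) {ε : ι → ℝ} (hε : ∀ i, 0 < ε i) :
    ∃ e : ι → H, Orthonormal ℂ e ∧ ∀ i, ‖A i (e i)‖ ≤ ε i := by
  classical
  obtain ⟨φ⟩ : Nonempty (ι ≃ ℕ) := inferInstance
  choose F hF1 hF2 hF3 using fun (n : ℕ) (s : Finset H) =>
    exists_approx_null_vector (hA (φ.symm n)) s (hε (φ.symm n))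
  set S : ℕ → Finset H := fun n => Nat.rec ∅ (fun k s => insert (F k s) s) n with hS
  have hSs : ∀ n, S (n + 1) = insert (F n (S n)) (S n) := fun n => rfl
  have hmono : Monotone S := monotone_nat_of_le_succ fun n => by
    rw [hSs]; exact Finset.subset_insert _ _
  have horth : ∀ m n, m < n → inner ℂ (F m (S m)) (F n (S n)) = 0 := fun m n hmn => by
    refine hF2 n _ _ (hmono (Nat.succ_le_of_lt hmn) ?_)
    rw [Nat.succ_eq_add_one, hSs]
    exact Finset.mem_insert_self _ _
  have hF : Orthonormal ℂ fun n => F n (S n) := by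
    refine ⟨fun n => hF1 _ _, fun m n hmn => ?_⟩
    rcases lt_or_gt_of_ne hmn with h | h
    · exact horth m n h
    · exact inner_eq_zero_symm.1 (horth n m h)
  refine ⟨fun i => F (φ i) (S (φ i)), hF.comp φ φ.injective, fun i => ?_⟩
  simpa using hF3 (φ i) (S (φ i))

omit [CompleteSpace H] in
theorem inner_block {ι : Type*} [Fintype ι] {e : ℕ × ι → H} (he : Orthonormal ℂ e) (x y x' y' : ι → ℂ)
    (m n : ℕ) :
    inner ℂ (∑ j, (x j • e (m + 1, j) + y j • e (m, j)))
      (∑ j, (x' j • e (n + 1, j) + y' j • e (n, j))) =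
    (if m = n then ∑ j, (star (x j) * x' j + star (y j) * y' j) else 0) +
      (if m + 1 = n then ∑ j, star (x j) * y' j else 0) +
      (if m = n + 1 then ∑ j, star (y j) * x' j else 0) := by
  classical
  have key : ∀ (m n : ℕ) (p q : ι → ℂ), inner ℂ (∑ j, p j • e (m, j)) (∑ j, q j • e (n, j)) =
      if m = n then ∑ j, star (p j) * q j else 0 := fun m n p q => by
    simp only [sum_inner, inner_sum, inner_smul_left, inner_smul_right, orthonormal_iff_ite.1 he,
      Prod.mk.injEq]
    split_ifs with h
    · simp [h, mul_comm]
    · simp [h]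
  simp only [Finset.sum_add_distrib, inner_add_left, inner_add_right, key, add_left_inj]
  split_ifs <;> ring

omit [CompleteSpace H] in
theorem norm_eq_one_of_not_essBoundedBelow {U : H →L[ℂ] H} (hU : ∀ x, ‖U x‖ = ‖x‖) {z : ℂ}
    (hz : ¬ EssBoundedBelow (U - z • 1)) : ‖z‖ = 1 := by
  by_contra h
  refine hz ⟨⊥, inferInstance, |1 - ‖z‖|, abs_pos.2 (sub_ne_zero.2 (Ne.symm h)), fun x _ => ?_⟩
  have h1 := abs_norm_sub_norm_le (U x) (z • x)
  rw [hU, norm_smul] at h1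
  have h2 : |1 - ‖z‖| * ‖x‖ = |‖x‖ - ‖z‖ * ‖x‖| := by
    rw [← abs_of_nonneg (norm_nonneg x), ← abs_mul, abs_of_nonneg (norm_nonneg x)]
    ring_nf
  rw [h2]
  exact h1

/-- A finitely supported weight system on the essential spectrum of a unitary operator produces an
orthonormal sequence on which the operator compresses to `r` times the shift, up to a small error. -/
theorem not_hasCN_of_weights {ι : Type*} [Fintype ι] {U : H →L[ℂ] H} (h₁ : adjoint U * U = 1)
    (h₂ : U * adjoint U = 1) {z x y : ι → ℂ} {r : ℝ}
    (hz : ∀ i, ¬ EssBoundedBelow (U - z i • 1)) (hr0 : 0 < r) (hr1 : r ≤ 1)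
    (hone : ∑ i, (‖x i‖ ^ 2 + ‖y i‖ ^ 2) = 1)
    (hmean : ∑ i, ((‖x i‖ ^ 2 + ‖y i‖ ^ 2 : ℝ) : ℂ) * z i = 0)
    (hyx : ∑ i, star (y i) * x i = 0) (hyxz : ∑ i, star (y i) * x i * z i = r)
    (hyxz' : ∑ i, star (y i) * x i * star (z i) = 0) : ¬ HasCN U := by
  have hU := norm_apply_of_adjoint_mul_eq_one h₁
  have hι : Nonempty ι := by
    by_contra hι
    rw [not_nonempty_iff] at hι
    simp at hone
  have hsq : ∀ a : ℂ, star a * a = ((‖a‖ ^ 2 : ℝ) : ℂ) := fun a => by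
    rw [RCLike.star_def, Complex.conj_mul']; push_cast; rfl
  have hle : ∀ i, ‖x i‖ ≤ 1 ∧ ‖y i‖ ≤ 1 := fun i => by
    have h1 := Finset.single_le_sum (f := fun i => ‖x i‖ ^ 2 + ‖y i‖ ^ 2)
      (fun i _ => by positivity) (Finset.mem_univ i)
    rw [hone] at h1
    constructor <;> nlinarith [norm_nonneg (x i), norm_nonneg (y i)]
  set c : ℝ := r / 8 / (2 * Fintype.card ι) with hc
  have hcard : (0 : ℝ) < Fintype.card ι := by exact_mod_cast Fintype.card_pos
  have hc0 : 0 < c := by positivity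
  obtain ⟨e, he, hAe⟩ := exists_orthonormal_approx_null (ι := ℕ × ι)
    (A := fun k => U - z k.2 • 1) (fun k => hz k.2) (ε := fun k => c * (1 / 2) ^ k.1)
    fun k => by positivity
  have hAe' : ∀ n j, ‖U (e (n, j)) - z j • e (n, j)‖ ≤ c * (1 / 2) ^ n := fun n j => hAe (n, j)
  have hz1 : ∀ i, ‖z i‖ = 1 := fun i => norm_eq_one_of_not_essBoundedBelow hU (hz i)
  set f : ℕ → H := fun n => ∑ j, (x j • e (n + 1, j) + y j • e (n, j)) with hf
  set g : ℕ → H := fun n => ∑ j, ((z j * x j) • e (n + 1, j) + (z j * y j) • e (n, j)) with hg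
  have hforth : Orthonormal ℂ f := by
    refine orthonormal_iff_ite.2 fun m n => ?_
    have h0 : ∑ j, (star (x j) * x j + star (y j) * y j) = 1 := by
      simp only [hsq]
      exact_mod_cast hone
    have h1 : ∑ j, star (x j) * y j = 0 := by
      simpa [mul_comm] using congrArg star hyx
    simp only [hf, inner_block he, h0, h1, hyx, ite_self, add_zero]
  refine not_hasCN_of_shift h₁ h₂ hforth (g := g) (r := r) (ε := r / 4) (by linarith)
    (by linarith) hr1 (fun m n => ?_) fun s => ?_
  · have h0 : ∑ j, (star (x j) * (z j * x j) + star (y j) * (z j * y j)) = 0 := by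
      rw [← hmean]
      refine Finset.sum_congr rfl fun j _ => ?_
      rw [Complex.ofReal_add, ← hsq, ← hsq]
      ring
    have h1 : ∑ j, star (x j) * (z j * y j) = 0 := by
      have h2 := congrArg star hyxz'
      rw [star_sum, star_zero] at h2
      rw [← h2]
      refine Finset.sum_congr rfl fun j _ => ?_
      simp only [star_mul, star_star]
      ring
    have h3 : ∑ j, star (y j) * (z j * x j) = r := by
      rw [← hyxz]
      exact Finset.sum_congr rfl fun j _ => by ring
    simp only [hf, hg, inner_block he, h0, h1, h3, ite_self, zero_add]
  · have hn : ∀ n, ‖U (f n) - g n‖ ≤ r / 8 * (1 / 2) ^ n := fun n => by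
      have h1 : U (f n) - g n = ∑ j, (x j • (U (e (n + 1, j)) - z j • e (n + 1, j)) +
          y j • (U (e (n, j)) - z j • e (n, j))) := by
        simp only [hf, hg, map_sum, map_add, map_smul, ← Finset.sum_sub_distrib]
        exact Finset.sum_congr rfl fun j _ => by module
      have h2 : ∀ j ∈ Finset.univ, ‖x j • (U (e (n + 1, j)) - z j • e (n + 1, j)) +
          y j • (U (e (n, j)) - z j • e (n, j))‖ ≤ 2 * c * (1 / 2) ^ n := fun j _ => by
        refine (norm_add_le _ _).trans ?_
        rw [norm_smul, norm_smul]
        have h3 := mul_le_mul (hle j).1 (hAe' (n + 1) j) (norm_nonneg _) zero_le_one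
        have h4 := mul_le_mul (hle j).2 (hAe' n j) (norm_nonneg _) zero_le_one
        have h5 : 0 < c * (1 / 2) ^ n := by positivity
        rw [pow_succ] at h3
        linarith
      rw [h1]
      refine (norm_sum_le_of_le _ h2).trans_eq ?_
      rw [Finset.sum_const, Finset.card_univ, nsmul_eq_mul, hc]
      field_simp
    calc ∑ n ∈ s, ‖U (f n) - g n‖ ≤ ∑ n ∈ s, r / 8 * (1 / 2) ^ n := Finset.sum_le_sum fun n _ => hn n
      _ ≤ ∑' n : ℕ, r / 8 * (1 / 2) ^ n :=
        (summable_geometric_two.mul_left _).sum_le_tsum s fun n _ => by positivity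
      _ = r / 4 := by rw [tsum_mul_left, tsum_geometric_two]; ring

/-- The essential spectrum of a unitary operator with property (CN) lies in a closed half-plane. -/
theorem not_hasCN_of_essential_spectrum {U : H →L[ℂ] H} (h₁ : adjoint U * U = 1)
    (h₂ : U * adjoint U = 1)
    (h : ∀ w : ℂ, ‖w‖ = 1 → ∃ z, ¬ EssBoundedBelow (U - z • 1) ∧ (w * z).re < 0) : ¬ HasCN U := by
  have hE : ∀ z ∈ {z : ℂ | ¬ EssBoundedBelow (U - z • 1)}, ‖z‖ = 1 := fun z hz =>
    norm_eq_one_of_not_essBoundedBelow (norm_apply_of_adjoint_mul_eq_one h₁) hz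
  obtain ⟨ι, _, t, z, ht, ht1, hz, hz0, hκ⟩ := exists_barycenter hE h
  set κ := ∑ i, (t i : ℂ) * z i ^ 2 with hκdef
  have hz1 : ∀ i, ‖z i‖ = 1 := fun i => hE _ (hz i)
  have hzz : ∀ i, z i * star (z i) = 1 := fun i => by
    rw [RCLike.star_def, Complex.mul_conj', hz1]; simp
  have ht1' : ∑ i, (t i : ℂ) = 1 := by exact_mod_cast ht1
  have hz0' : ∑ i, (t i : ℂ) * star (z i) = 0 := by
    have := congrArg star hz0
    simpa using this
  have hκ' : ∑ i, (t i : ℂ) * star (z i) ^ 2 = star κ := by simp [hκdef]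
  set w : ι → ℂ := fun i => t i * (star (z i) - star κ * z i) / 4 with hw
  have hwt : ∀ i, 2 * ‖w i‖ ≤ t i := fun i => by
    have h1 : ‖star (z i) - star κ * z i‖ ≤ 2 := by
      refine (norm_sub_le _ _).trans ?_
      rw [norm_mul, norm_star, norm_star, hz1]
      linarith
    simp only [hw, norm_div, norm_mul, Complex.norm_real, Real.norm_of_nonneg (ht i),
      Complex.norm_ofNat]
    linarith [mul_le_mul_of_nonneg_left h1 (ht i)]
  choose x y hxy hxyt using fun i => exists_conj_mul_eq (hwt i)
  set r := (1 - ‖κ‖ ^ 2) / 4 with hr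
  have hr0 : 0 < r := by
    have : ‖κ‖ ^ 2 < 1 := pow_lt_one₀ (norm_nonneg _) hκ two_ne_zero
    linarith
  have hr1 : r ≤ 1 := by nlinarith [sq_nonneg ‖κ‖]
  have hw0 : ∑ i, w i = 0 := by
    have h1 : ∑ i, w i = (∑ i, (t i : ℂ) * star (z i) - star κ * ∑ i, (t i : ℂ) * z i) / 4 := by
      rw [Finset.mul_sum, ← Finset.sum_sub_distrib, Finset.sum_div]
      exact Finset.sum_congr rfl fun i _ => by simp only [hw]; ring
    rw [h1, hz0, hz0']; simp
  have hwz : ∑ i, w i * z i = r := by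
    have h1 : ∑ i, w i * z i = (∑ i, (t i : ℂ) - star κ * κ) / 4 := by
      rw [hκdef, Finset.mul_sum, ← Finset.sum_sub_distrib, Finset.sum_div]
      exact Finset.sum_congr rfl fun i _ => by
        simp only [hw]
        linear_combination (t i : ℂ) / 4 * hzz i
    rw [h1, ht1', RCLike.star_def, Complex.conj_mul', hr]
    push_cast
    ring
  have hwz' : ∑ i, w i * star (z i) = 0 := by
    have h1 : ∑ i, w i * star (z i) =
        (∑ i, (t i : ℂ) * star (z i) ^ 2 - star κ * ∑ i, (t i : ℂ)) / 4 := by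
      rw [Finset.mul_sum, ← Finset.sum_sub_distrib, Finset.sum_div]
      exact Finset.sum_congr rfl fun i _ => by
        simp only [hw]
        linear_combination -(t i : ℂ) * star κ / 4 * hzz i
    rw [h1, hκ', ht1']; simp
  exact not_hasCN_of_weights h₁ h₂ hz hr0 hr1 (x := x) (y := y) (by simpa only [hxyt] using ht1)
    (by simpa only [hxyt] using hz0) (by simpa only [hxy] using hw0)
    (by simpa only [hxy] using hwz) (by simpa only [hxy] using hwz')

theorem HasCN.exists_essBoundedBelow {U : H →L[ℂ] H} (hU : HasCN U) (h₁ : adjoint U * U = 1)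
    (h₂ : U * adjoint U = 1) :
    ∃ w : ℂ, ‖w‖ = 1 ∧ ∀ z : ℂ, z.re < 0 → EssBoundedBelow (w • U - z • 1) := by
  by_contra! h
  refine not_hasCN_of_essential_spectrum h₁ h₂ (fun w hw => ?_) hU
  obtain ⟨z, hz, hzE⟩ := h w hw
  have hw0 : w ≠ 0 := norm_ne_zero_iff.1 (by simp [hw])
  refine ⟨w⁻¹ * z, fun ⟨M, hM, c, hc, hMc⟩ => hzE ⟨M, hM, c, hc, fun x hx => ?_⟩, by
    rwa [mul_inv_cancel_left₀ hw0]⟩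
  have h1 : w • U - z • (1 : H →L[ℂ] H) = w • (U - (w⁻¹ * z) • 1) := by
    rw [smul_sub, smul_smul, mul_inv_cancel_left₀ hw0]
  rw [h1]
  refine (hMc x hx).trans_eq ?_
  change _ = ‖w • (U - (w⁻¹ * z) • 1) x‖
  rw [norm_smul, hw, one_mul]

end CN

theorem stmt12 {H : Type*} [NormedAddCommGroup H] [InnerProductSpace ℂ H]
    [CompleteSpace H] [TopologicalSpace.SeparableSpace H]
    (hinf : ¬ FiniteDimensional ℂ H) (T : H →L[ℂ] H) :
    HasCN T ↔
      ((∃ (fl mu : ℂ) (L : H →L[ℂ] H), ContinuousLinearMap.adjoint L = L ∧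
          T = fl • 1 + mu • L) ∨
       (∃ (fl mu : ℂ) (U : H →L[ℂ] H), mu ≠ 0 ∧
          ContinuousLinearMap.adjoint U * U = 1 ∧ U * ContinuousLinearMap.adjoint U = 1 ∧
          (∀ z : ℂ, z.re < 0 → IsFredholmOp (U - z • 1)) ∧
          T = fl • 1 + mu • U)) := by
  constructor
  · intro hT
    have : Nontrivial H := by
      by_contra hN
      rw [not_nontrivial_iff_subsingleton] at hN
      exact hinf inferInstance
    rcases hT.line_or_circle with h | ⟨l, m, U, hm, h₁, h₂, rfl⟩
    · exact Or.inl h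
    have hU : HasCN U := by
      have h3 := hT.smul_one_add_smul (-(m⁻¹ * l)) m⁻¹
      rwa [smul_add, smul_smul, smul_smul, inv_mul_cancel₀ hm, one_smul, neg_smul,
        neg_add_cancel_left] at h3
    obtain ⟨w, hw, hwU⟩ := hU.exists_essBoundedBelow h₁ h₂
    have hw0 : w ≠ 0 := norm_ne_zero_iff.1 (by simp [hw])
    have hww : (starRingEnd ℂ) w * w = 1 := by rw [Complex.conj_mul', hw]; simp
    have h₁' : adjoint (w • U) * (w • U) = 1 := by
      rw [map_smulₛₗ, smul_mul_smul_comm, hww, h₁, one_smul]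
    have h₂' : (w • U) * adjoint (w • U) = 1 := by
      rw [map_smulₛₗ, smul_mul_smul_comm, mul_comm w, hww, h₂, one_smul]
    refine Or.inr ⟨l, m * w⁻¹, w • U, mul_ne_zero hm (inv_ne_zero hw0), h₁', h₂', fun z hz =>
      EssBoundedBelow.isFredholmOp
        (isStarNormal_sub_smul_one (isStarNormal_of_unitary h₁' h₂') z) (hwU z hz), ?_⟩
    rw [smul_smul, inv_mul_cancel_right₀ hw0]
  · rintro (⟨l, m, L, hL, rfl⟩ | ⟨l, m, U, -, h₁, h₂, hF, rfl⟩)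
    · exact (hasCN_of_adjoint_eq_self hL).smul_one_add_smul l m
    · exact (hasCN_of_unitary h₁ h₂ hF).smul_one_add_smul l m
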